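/- arXiv:1501.05005 — 5 statements merged into one kernel-verified Lean document; each statement's English description precedes it below -/
import Mathlib

section
/- Fix a1, a2 ∈ [0,1]. Let X1, X2 be independent {0,1}-valued random variables with P(X_i = 0) = a_i, and set U1 := X1 ⊕ X2, U2 := X2. Define h⁻ := −log₂(a1∗a2) on {U1 = 0} and −log₂(1 − a1∗a2) on {U1 = 1}; define h⁺ := −log₂(a1a2/(a1∗a2)) on {U1 = 0, U2 = 0}, −log₂(1 − a1a2/(a1∗a2)) on {U1 = 0, U2 = 1}, −log₂((1−a1)a2/((1−a1)∗a2)) on {U1 = 1, U2 = 0}, and −log₂(1 − (1−a1)a2/((1−a1)∗a2)) on {U1 = 1, U2 = 1} (with the convention that −log₂ of 0 or of an expression with vanishing denominator is 0; the corresponding events have probability zero). Then Cov(h⁻, h⁺) = f(a1,a2). -/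
open MeasureTheory ProbabilityTheory Real

/-- The binary entropy function `ℋ(p) = -p log₂ p - (1-p) log₂ (1-p)`. -/
noncomputable def binH (p : ℝ) : ℝ := -(p * Real.logb 2 p) - (1 - p) * Real.logb 2 (1 - p)

/-- The convolution `p ∗ q = pq + (1-p)(1-q)`. -/
noncomputable def pstar (p q : ℝ) : ℝ := p * q + (1 - p) * (1 - q)

/-- The function `f(p,q)`. -/
noncomputable def fpq (p q : ℝ) : ℝ :=
  (pstar p q) * (pstar p (1 - q)) * Real.logb 2 ((pstar p q) / (pstar p (1 - q)))
    * (binH (p * (1 - q) / pstar p (1 - q)) - binH (p * q / pstar p q))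

/-- Covariance of two real random variables: `Cov(F,G) = E[FG] - E[F]E[G]`. -/
noncomputable def cov {Ω : Type*} [MeasurableSpace Ω] (μ : Measure Ω) (F G : Ω → ℝ) : ℝ :=
  (∫ ω, F ω * G ω ∂μ) - (∫ ω, F ω ∂μ) * (∫ ω, G ω ∂μ)

lemma aux_int {Ω : Type*} [MeasurableSpace Ω] (μ : Measure Ω) [IsProbabilityMeasure μ]
    (a₁ a₂ : ℝ) (X₁ X₂ : Ω → ZMod 2) (hX₁ : Measurable X₁) (hX₂ : Measurable X₂)
    (hindep : IndepFun X₁ X₂ μ)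
    (hP₁ : (μ {ω | X₁ ω = 0}).toReal = a₁) (hP₂ : (μ {ω | X₂ ω = 0}).toReal = a₂)
    (g : ZMod 2 → ZMod 2 → ℝ) :
    ∫ ω, g (X₁ ω) (X₂ ω) ∂μ = a₁ * a₂ * g 0 0 + a₁ * (1 - a₂) * g 0 1
      + (1 - a₁) * a₂ * g 1 0 + (1 - a₁) * (1 - a₂) * g 1 1 := by
  have key : ∀ (X : Ω → ZMod 2) (a : ℝ), Measurable X → (μ {ω | X ω = 0}).toReal = a →
      μ.real (X ⁻¹' {0}) = a ∧ μ.real (X ⁻¹' {1}) = 1 - a := by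
    intro X a hX h
    have h0 : μ.real (X ⁻¹' {0}) = a := h
    refine ⟨h0, ?_⟩
    have h1 : X ⁻¹' {1} = (X ⁻¹' {0})ᶜ := by
      ext ω
      simp only [Set.mem_preimage, Set.mem_singleton_iff, Set.mem_compl_iff]
      generalize X ω = z
      revert z; decide
    rw [h1, probReal_compl_eq_one_sub (hX (measurableSet_singleton 0)), h0]
  obtain ⟨h10, h11⟩ := key X₁ a₁ hX₁ hP₁
  obtain ⟨h20, h21⟩ := key X₂ a₂ hX₂ hP₂
  have hpair : ∀ x y : ZMod 2, μ.real ((X₁ ⁻¹' {x}) ∩ (X₂ ⁻¹' {y}))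
      = μ.real (X₁ ⁻¹' {x}) * μ.real (X₂ ⁻¹' {y}) := by
    intro x y
    simp only [Measure.real]
    rw [hindep.measure_inter_preimage_eq_mul _ _ (measurableSet_singleton x)
      (measurableSet_singleton y), ENNReal.toReal_mul]
  have hind : ∀ ω, g (X₁ ω) (X₂ ω) = ∑ x : ZMod 2, ∑ y : ZMod 2,
      ((X₁ ⁻¹' {x}) ∩ (X₂ ⁻¹' {y})).indicator (fun _ => g x y) ω := by
    intro ω
    rw [Finset.sum_eq_single (X₁ ω), Finset.sum_eq_single (X₂ ω)]
    · rw [Set.indicator_of_mem (by exact ⟨rfl, rfl⟩)]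
    · intro b _ hb
      exact Set.indicator_of_notMem (fun h => hb h.2.symm) _
    · intro h; exact absurd (Finset.mem_univ _) h
    · intro b _ hb
      exact Finset.sum_eq_zero fun y _ => Set.indicator_of_notMem (fun h => hb h.1.symm) _
    · intro h; exact absurd (Finset.mem_univ _) h
  have hms : ∀ x y : ZMod 2, MeasurableSet ((X₁ ⁻¹' {x}) ∩ (X₂ ⁻¹' {y})) := fun x y =>
    (hX₁ (measurableSet_singleton x)).inter (hX₂ (measurableSet_singleton y))
  have hi : ∀ x y : ZMod 2, Integrable
      (((X₁ ⁻¹' {x}) ∩ (X₂ ⁻¹' {y})).indicator (fun _ => g x y)) μ := fun x y =>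
    (integrable_const _).indicator (hms x y)
  simp_rw [hind]
  rw [integral_finsetSum _ (fun x _ => integrable_finsetSum _ (fun y _ => hi x y))]
  simp_rw [integral_finsetSum _ (fun y _ => hi _ y), integral_indicator_const _ (hms _ _), hpair]
  have hs : ∀ F : ZMod 2 → ℝ, ∑ x, F x = F 0 + F 1 := fun F => Fin.sum_univ_two F
  simp only [hs, h10, h11, h20, h21, smul_eq_mul]
  ring

lemma aux_H (u v s : ℝ) (hu : 0 ≤ u) (hv : 0 ≤ v) (hs : s = u + v) :
    u * (- Real.logb 2 (u / s)) + v * (- Real.logb 2 (1 - u / s)) = s * binH (u / s) := by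
  by_cases h : s = 0
  · have : u = 0 := by linarith
    have : v = 0 := by linarith
    simp [*]
  · unfold binH
    have e1 : s * (u / s) = u := by field_simp
    have e2 : v = s - u := by linarith
    rw [e2]
    generalize Real.logb 2 (1 - u / s) = L
    generalize Real.logb 2 (u / s) = M
    linear_combination (M - L) * e1

lemma binH_symm (p : ℝ) : binH (1 - p) = binH p := by
  unfold binH; rw [sub_sub_cancel]; ring

/-- For fixed `a₁, a₂ ∈ [0,1]` and independent binary `X₁, X₂` with `P(Xᵢ = 0) = aᵢ`,
the covariance of the pointwise entropy values `h⁻, h⁺` at the output of the polar transform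
`U₁ = X₁ ⊕ X₂`, `U₂ = X₂` equals `f(a₁,a₂)`. (In Lean, `-logb 2` of `0` or of an expression
with vanishing denominator is `0`, implementing the stated conventions.) -/
theorem cov_entropy_values_eq_fpq
    {Ω : Type*} [MeasurableSpace Ω] (μ : Measure Ω) [IsProbabilityMeasure μ]
    (a₁ a₂ : ℝ) (ha₁ : a₁ ∈ Set.Icc (0:ℝ) 1) (ha₂ : a₂ ∈ Set.Icc (0:ℝ) 1)
    (X₁ X₂ : Ω → ZMod 2) (hX₁ : Measurable X₁) (hX₂ : Measurable X₂)
    (hindep : IndepFun X₁ X₂ μ)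
    (hP₁ : (μ {ω | X₁ ω = 0}).toReal = a₁) (hP₂ : (μ {ω | X₂ ω = 0}).toReal = a₂)
    (hm hp : Ω → ℝ)
    (hhm : ∀ ω, hm ω = if X₁ ω + X₂ ω = 0
        then - Real.logb 2 (pstar a₁ a₂)
        else - Real.logb 2 (1 - pstar a₁ a₂))
    (hhp : ∀ ω, hp ω =
        if X₁ ω + X₂ ω = 0 then
          (if X₂ ω = 0 then - Real.logb 2 (a₁ * a₂ / pstar a₁ a₂)
           else - Real.logb 2 (1 - a₁ * a₂ / pstar a₁ a₂))
        else
          (if X₂ ω = 0 then - Real.logb 2 ((1 - a₁) * a₂ / pstar (1 - a₁) a₂)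
           else - Real.logb 2 (1 - (1 - a₁) * a₂ / pstar (1 - a₁) a₂))) :
    cov μ hm hp = fpq a₁ a₂ := by
  obtain ⟨h1, h1'⟩ := ha₁
  obtain ⟨h2, h2'⟩ := ha₂
  have I := aux_int μ a₁ a₂ X₁ X₂ hX₁ hX₂ hindep hP₁ hP₂
  have z1 : (1 : ZMod 2) ≠ 0 := by decide
  have z2 : (1 : ZMod 2) + 1 = 0 := by decide
  have et : pstar (1 - a₁) a₂ = 1 - pstar a₁ a₂ := by unfold pstar; ring
  have et' : pstar a₁ (1 - a₂) = 1 - pstar a₁ a₂ := by unfold pstar; ring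
  have hA := aux_H (a₁ * a₂) ((1 - a₁) * (1 - a₂)) (pstar a₁ a₂) (by nlinarith) (by nlinarith) rfl
  have hB := aux_H ((1 - a₁) * a₂) (a₁ * (1 - a₂)) (1 - pstar a₁ a₂)
    (by nlinarith) (by nlinarith) (by unfold pstar; ring)
  have hH : (1 - pstar a₁ a₂) * binH (a₁ * (1 - a₂) / (1 - pstar a₁ a₂))
      = (1 - pstar a₁ a₂) * binH ((1 - a₁) * a₂ / (1 - pstar a₁ a₂)) := by
    by_cases ht : 1 - pstar a₁ a₂ = 0
    · simp [ht]
    · rw [← binH_symm ((1 - a₁) * a₂ / (1 - pstar a₁ a₂))]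
      congr 2
      field_simp
      unfold pstar; ring
  have hlog : pstar a₁ a₂ * (1 - pstar a₁ a₂) *
      Real.logb 2 (pstar a₁ a₂ / (1 - pstar a₁ a₂)) = pstar a₁ a₂ * (1 - pstar a₁ a₂) *
      (Real.logb 2 (pstar a₁ a₂) - Real.logb 2 (1 - pstar a₁ a₂)) := by
    by_cases hs : pstar a₁ a₂ = 0
    · simp [hs]
    by_cases ht : 1 - pstar a₁ a₂ = 0
    · simp [ht]
    rw [Real.logb_div hs ht]
  have hs : a₁ * a₂ + (1 - a₁) * (1 - a₂) = pstar a₁ a₂ := rfl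
  unfold cov fpq
  rw [et', hlog]
  rw [et] at hhp
  simp_rw [hhm, hhp]
  generalize Real.logb 2 (pstar a₁ a₂ / (1 - pstar a₁ a₂)) = Q at *
  generalize Real.logb 2 (pstar a₁ a₂) = S at *
  generalize Real.logb 2 (1 - pstar a₁ a₂) = T at *
  generalize Real.logb 2 (a₁ * a₂ / pstar a₁ a₂) = L1 at *
  generalize Real.logb 2 (1 - a₁ * a₂ / pstar a₁ a₂) = L2 at *
  generalize Real.logb 2 ((1 - a₁) * a₂ / (1 - pstar a₁ a₂)) = L3 at *
  generalize Real.logb 2 (1 - (1 - a₁) * a₂ / (1 - pstar a₁ a₂)) = L4 at *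
  generalize binH (a₁ * a₂ / pstar a₁ a₂) = H1 at *
  generalize binH ((1 - a₁) * a₂ / (1 - pstar a₁ a₂)) = H2 at *
  generalize binH (a₁ * (1 - a₂) / (1 - pstar a₁ a₂)) = H3 at *
  have I1 := I (fun x y => (if x + y = 0 then -S else -T) *
    (if x + y = 0 then (if y = 0 then -L1 else -L2) else (if y = 0 then -L3 else -L4)))
  have I2 := I (fun x y => if x + y = 0 then -S else -T)
  have I3 := I (fun x y =>
    if x + y = 0 then (if y = 0 then -L1 else -L2) else (if y = 0 then -L3 else -L4))
  simp only [z1, z2, add_zero, zero_add, if_true, if_false] at I1 I2 I3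
  have J1 : ∀ s : ℝ, a₁ * a₂ + (1 - a₁) * (1 - a₂) = s → 
    a₁ * (1 - a₂) + (1 - a₁) * a₂ = 1 - s := by intro s h; linarith
  have J2 := J1 _ hs
  rw [I1, I2, I3]
  generalize pstar a₁ a₂ = s at *
  have K1 : a₁ * a₂ * (-S * -L1) + a₁ * (1 - a₂) * (-T * -L4) + (1 - a₁) * a₂ * (-T * -L3)
      + (1 - a₁) * (1 - a₂) * (-S * -L2) = -S * (s * H1) - T * ((1 - s) * H2) := by
    rw [← hA, ← hB]; ring
  have K2 : a₁ * a₂ * -S + a₁ * (1 - a₂) * -T + (1 - a₁) * a₂ * -T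
      + (1 - a₁) * (1 - a₂) * -S = -S * s - T * (1 - s) := by
    rw [← hs]; ring
  have K3 : a₁ * a₂ * -L1 + a₁ * (1 - a₂) * -L4 + (1 - a₁) * a₂ * -L3
      + (1 - a₁) * (1 - a₂) * -L2 = s * H1 + (1 - s) * H2 := by
    rw [← hA, ← hB]; ring
  rw [K1, K2, K3]
  linear_combination (-s * (S - T)) * hH
end

section
/- Let A1 and A2 be independent random variables taking values in [0,1]. Then E[f(A1,A2)] ≥ 0, and E[f(A1,A2)] = 0 if and only if A1 ∈ {0, 1/2, 1} almost surely or A2 ∈ {0, 1/2, 1} almost surely. -/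
open MeasureTheory ProbabilityTheory Real

lemma binH_eq (x : ℝ) : binH x = Real.binEntropy x / Real.log 2 := by
  unfold binH Real.binEntropy Real.logb
  rw [Real.log_inv, Real.log_inv]
  ring

lemma binEntropy_fold (x : ℝ) : Real.binEntropy x = Real.binEntropy (1/2 - |x - 1/2|) := by
  rcases le_total x (1/2) with h | h
  · rw [abs_of_nonpos (by linarith)]
    congr 1; ring
  · rw [abs_of_nonneg (by linarith), ← Real.binEntropy_one_sub]
    congr 1; ring

lemma binH_lt {x y : ℝ} (hx0 : 0 ≤ x) (hx1 : x ≤ 1)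
    (h : (y - 1/2)^2 < (x - 1/2)^2) : binH x < binH y := by
  rw [binH_eq, binH_eq]
  have hl : 0 < Real.log 2 := Real.log_pos (by norm_num)
  apply div_lt_div_of_pos_right _ hl
  rw [binEntropy_fold x, binEntropy_fold y]
  have h1 : |y - 1/2| < |x - 1/2| := sq_lt_sq.mp h
  have h2 : |x - 1/2| ≤ 1/2 := abs_le.mpr ⟨by linarith, by linarith⟩
  have h3 := abs_nonneg (x - 1/2)
  have h4 := abs_nonneg (y - 1/2)
  apply Real.binEntropy_strictMonoOn
  · constructor <;> norm_num <;> linarith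
  · constructor <;> norm_num <;> linarith
  · linarith

lemma binH_zero : binH 0 = 0 := by simp [binH]

lemma binH_one : binH 1 = 0 := by simp [binH]

lemma binH_abs_le {x : ℝ} (hx0 : 0 ≤ x) (hx1 : x ≤ 1) : 0 ≤ binH x ∧ binH x ≤ 1 := by
  have hl : 0 < Real.log 2 := Real.log_pos (by norm_num)
  rw [binH_eq]
  exact ⟨div_nonneg (Real.binEntropy_nonneg hx0 hx1) hl.le,
    (div_le_one hl).mpr Real.binEntropy_le_log_two⟩

lemma div_01 {u a : ℝ} (hu : 0 ≤ u) (h : u ≤ a) : 0 ≤ u / a ∧ u / a ≤ 1 :=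
  ⟨div_nonneg hu (hu.trans h), div_le_one_of_le₀ h (hu.trans h)⟩

lemma pstar_nonneg {p q : ℝ} (hp : p ∈ Set.Icc (0:ℝ) 1) (hq : q ∈ Set.Icc (0:ℝ) 1) :
    0 ≤ p * q ∧ p * q ≤ pstar p q := by
  obtain ⟨h0, h1⟩ := hp
  obtain ⟨h2, h3⟩ := hq
  have := mul_nonneg (sub_nonneg.mpr h1) (sub_nonneg.mpr h3)
  exact ⟨mul_nonneg h0 h2, by unfold pstar; linarith⟩

lemma one_sub_mem {q : ℝ} (hq : q ∈ Set.Icc (0:ℝ) 1) : 1 - q ∈ Set.Icc (0:ℝ) 1 :=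
  ⟨by linarith [hq.2], by linarith [hq.1]⟩

lemma pstar_one_sub (p q : ℝ) : pstar p (1 - q) = 1 - pstar p q := by
  unfold pstar; ring

lemma binH_div_self (x : ℝ) : binH (x / x) = 0 := by
  rcases eq_or_ne x 0 with h | h
  · simp [h, binH_zero]
  · simp [h, binH_one]

lemma fpq_zero {p q : ℝ} (h : p ∈ ({0, 1/2, 1} : Set ℝ) ∨ q ∈ ({0, 1/2, 1} : Set ℝ)) :
    fpq p q = 0 := by
  simp only [Set.mem_insert_iff, Set.mem_singleton_iff] at h
  unfold fpq
  rcases h with (h | h | h) | (h | h | h) <;> subst h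
  · simp [binH_zero]
  · have : pstar (1/2) q = pstar (1/2) (1 - q) := by unfold pstar; ring
    rw [this]
    rcases eq_or_ne (pstar (1/2) (1 - q)) 0 with h | h
    · rw [h, zero_mul, zero_mul, zero_mul]
    · rw [div_self h, Real.logb_one, mul_zero, zero_mul]
  · simp [pstar, binH_div_self]
  · simp [pstar, binH_zero, binH_div_self]
  · norm_num
  · simp [pstar, binH_zero, binH_div_self]

lemma fpq_pos {p q : ℝ} (hp : p ∈ Set.Ioo (0:ℝ) 1) (hq : q ∈ Set.Ioo (0:ℝ) 1)
    (hp2 : p ≠ 1/2) (hq2 : q ≠ 1/2) : 0 < fpq p q := by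
  obtain ⟨hp0, hp1⟩ := hp
  obtain ⟨hq0, hq1⟩ := hq
  have A1 : 0 < p * q := mul_pos hp0 hq0
  have A2 : 0 < (1 - p) * (1 - q) := mul_pos (by linarith) (by linarith)
  have B1 : 0 < p * (1 - q) := mul_pos hp0 (by linarith)
  have B2 : 0 < (1 - p) * q := mul_pos (by linarith) hq0
  have hA : 0 < pstar p q := by unfold pstar; linarith
  have hB : 0 < pstar p (1 - q) := by
    unfold pstar; rw [sub_sub_cancel]; linarith
  have hx := div_01 A1.le (show p * q ≤ pstar p q by unfold pstar; linarith)
  have hy := div_01 B1.le (show p * (1 - q) ≤ pstar p (1 - q) by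
    unfold pstar; rw [sub_sub_cancel]; linarith)
  have key : (p * q / pstar p q - 1/2)^2 - (p * (1 - q) / pstar p (1 - q) - 1/2)^2
      = (2*p-1)*(2*q-1) * (p*(1-p)*(q*(1-q)) / (pstar p q * pstar p (1-q))^2) := by
    have hA' := hA.ne'
    have hB' := hB.ne'
    field_simp
    unfold pstar
    ring
  have hc : 0 < p*(1-p)*(q*(1-q)) / (pstar p q * pstar p (1-q))^2 := by
    have : 0 < 1 - p := by linarith
    have : 0 < 1 - q := by linarith
    positivity
  have hd : pstar p q - pstar p (1 - q) = (2*p-1)*(2*q-1) := by unfold pstar; ring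
  have hne : (2*p-1)*(2*q-1) ≠ 0 := by
    apply mul_ne_zero
    · intro h; apply hp2; linarith
    · intro h; apply hq2; linarith
  have hAB := mul_pos hA hB
  unfold fpq
  rcases lt_or_gt_of_ne hne with h | h
  · have h1 : Real.logb 2 (pstar p q / pstar p (1 - q)) < 0 :=
      Real.logb_neg (by norm_num) (div_pos hA hB) ((div_lt_one hB).mpr (by linarith))
    have h2 := binH_lt hy.1 hy.2 (y := p * q / pstar p q)
      (by have := mul_neg_of_neg_of_pos h hc; linarith)
    exact mul_pos_of_neg_of_neg (mul_neg_of_pos_of_neg hAB h1) (by linarith)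
  · have h1 : 0 < Real.logb 2 (pstar p q / pstar p (1 - q)) :=
      Real.logb_pos (by norm_num) ((one_lt_div hB).mpr (by linarith))
    have h2 := binH_lt hx.1 hx.2 (y := p * (1 - q) / pstar p (1 - q))
      (by have := mul_pos h hc; linarith)
    exact mul_pos (mul_pos hAB h1) (by linarith)

lemma fpq_pos' {p q : ℝ} (hp : p ∈ Set.Icc (0:ℝ) 1) (hq : q ∈ Set.Icc (0:ℝ) 1)
    (hp2 : p ∉ ({0, 1/2, 1} : Set ℝ)) (hq2 : q ∉ ({0, 1/2, 1} : Set ℝ)) : 0 < fpq p q := by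
  simp only [Set.mem_insert_iff, Set.mem_singleton_iff, not_or] at hp2 hq2
  exact fpq_pos ⟨lt_of_le_of_ne hp.1 (Ne.symm hp2.1), lt_of_le_of_ne hp.2 hp2.2.2⟩
    ⟨lt_of_le_of_ne hq.1 (Ne.symm hq2.1), lt_of_le_of_ne hq.2 hq2.2.2⟩ hp2.2.1 hq2.2.1

lemma fpq_nonneg {p q : ℝ} (hp : p ∈ Set.Icc (0:ℝ) 1) (hq : q ∈ Set.Icc (0:ℝ) 1) :
    0 ≤ fpq p q := by
  by_cases h : p ∈ ({0, 1/2, 1} : Set ℝ) ∨ q ∈ ({0, 1/2, 1} : Set ℝ)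
  · exact (fpq_zero h).ge
  · rw [not_or] at h
    exact (fpq_pos' hp hq h.1 h.2).le

lemma log_bound {a b : ℝ} (ha : 0 ≤ a) (hb : 0 ≤ b) (hab : a + b = 1) :
    |a * b * Real.logb 2 (a / b)| ≤ 2 / Real.log 2 := by
  have hl : 0 < Real.log 2 := Real.log_pos (by norm_num)
  rcases ha.eq_or_lt with h | ha'
  · rw [← h]; simp; positivity
  rcases hb.eq_or_lt with h | hb'
  · rw [← h]; simp; positivity
  have e : a * b * Real.logb 2 (a / b)
      = (b * (Real.log a * a) - a * (Real.log b * b)) / Real.log 2 := by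
    rw [Real.logb, Real.log_div ha'.ne' hb'.ne']; ring
  rw [e, abs_div, abs_of_pos hl]
  apply div_le_div_of_nonneg_right _ hl.le
  have h1 := (Real.abs_log_mul_self_lt a ha' (by linarith)).le
  have h2 := (Real.abs_log_mul_self_lt b hb' (by linarith)).le
  have h3 : |b * (Real.log a * a)| ≤ 1 := by
    rw [abs_mul, abs_of_pos hb']
    exact mul_le_one₀ (by linarith) (abs_nonneg _) h1
  have h4 : |a * (Real.log b * b)| ≤ 1 := by
    rw [abs_mul, abs_of_pos ha']
    exact mul_le_one₀ (by linarith) (abs_nonneg _) h2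
  exact (abs_sub _ _).trans (by linarith)

lemma fpq_bound {p q : ℝ} (hp : p ∈ Set.Icc (0:ℝ) 1) (hq : q ∈ Set.Icc (0:ℝ) 1) :
    |fpq p q| ≤ 2 / Real.log 2 := by
  have hl : 0 < Real.log 2 := Real.log_pos (by norm_num)
  have a := pstar_nonneg hp hq
  have b := pstar_nonneg hp (one_sub_mem hq)
  have h1 := log_bound (a.1.trans a.2) (b.1.trans b.2) (by rw [pstar_one_sub]; ring)
  have hx := div_01 a.1 a.2
  have hy := div_01 b.1 b.2
  have hx' := binH_abs_le hx.1 hx.2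
  have hy' := binH_abs_le hy.1 hy.2
  unfold fpq
  rw [abs_mul]
  have h2 : |binH (p * (1 - q) / pstar p (1 - q)) - binH (p * q / pstar p q)| ≤ 1 :=
    abs_le.mpr ⟨by linarith, by linarith⟩
  calc _ ≤ 2 / Real.log 2 * 1 := mul_le_mul h1 h2 (abs_nonneg _) (by positivity)
    _ = _ := mul_one _

lemma fpq_measurable : Measurable (fun x : ℝ × ℝ => fpq x.1 x.2) := by
  unfold fpq binH pstar Real.logb
  fun_prop

/-- For independent `[0,1]`-valued random variables `A₁, A₂`, `E[f(A₁,A₂)] ≥ 0`, with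
equality iff `A₁ ∈ {0,1/2,1}` a.s. or `A₂ ∈ {0,1/2,1}` a.s. -/
theorem expectation_fpq_nonneg_and_eq_zero_iff
    {Ω : Type*} [MeasurableSpace Ω] (μ : Measure Ω) [IsProbabilityMeasure μ]
    (A₁ A₂ : Ω → ℝ) (hA₁ : Measurable A₁) (hA₂ : Measurable A₂)
    (hA₁01 : ∀ ω, A₁ ω ∈ Set.Icc (0:ℝ) 1) (hA₂01 : ∀ ω, A₂ ω ∈ Set.Icc (0:ℝ) 1)
    (hindep : IndepFun A₁ A₂ μ) :
    0 ≤ ∫ ω, fpq (A₁ ω) (A₂ ω) ∂μ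
    ∧ ((∫ ω, fpq (A₁ ω) (A₂ ω) ∂μ) = 0
      ↔ (∀ᵐ ω ∂μ, A₁ ω ∈ ({0, 1/2, 1} : Set ℝ))
        ∨ (∀ᵐ ω ∂μ, A₂ ω ∈ ({0, 1/2, 1} : Set ℝ))) := by
  have hS : MeasurableSet ({0, 1/2, 1} : Set ℝ) := (Set.toFinite _).measurableSet
  have hnn : ∀ ω, 0 ≤ fpq (A₁ ω) (A₂ ω) := fun ω => fpq_nonneg (hA₁01 ω) (hA₂01 ω)
  refine ⟨integral_nonneg hnn, ?_⟩
  have hint : Integrable (fun ω => fpq (A₁ ω) (A₂ ω)) μ := by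
    refine Integrable.of_bound (C := 2 / Real.log 2)
      (fpq_measurable.comp (hA₁.prodMk hA₂)).aestronglyMeasurable ?_
    exact Filter.Eventually.of_forall fun ω => fpq_bound (hA₁01 ω) (hA₂01 ω)
  rw [integral_eq_zero_iff_of_nonneg hnn hint]
  constructor
  · intro h
    have hz : μ (A₁ ⁻¹' ({0, 1/2, 1} : Set ℝ)ᶜ ∩ A₂ ⁻¹' ({0, 1/2, 1} : Set ℝ)ᶜ) = 0 := by
      refine measure_mono_null ?_ (ae_iff.mp h)
      rintro ω ⟨h1, h2⟩
      exact (fpq_pos' (hA₁01 ω) (hA₂01 ω) h1 h2).ne'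
    rw [hindep.measure_inter_preimage_eq_mul _ _ hS.compl hS.compl, mul_eq_zero] at hz
    rcases hz with hz | hz
    · exact Or.inl (ae_iff.mpr hz)
    · exact Or.inr (ae_iff.mpr hz)
  · rintro (h | h)
    · filter_upwards [h] with ω hω using fpq_zero (Or.inl hω)
    · filter_upwards [h] with ω hω using fpq_zero (Or.inr hω)
end

section
/- Let (X1,Y1) and (X2,Y2) be BDEs on a common probability space such that the pair (X1,Y1) is independent of the pair (X2,Y2); set U1 := X1 + X2 (in 𝔽₂), U2 := X2, Ȳ := (Y1,Y2), let h⁻ := h(U1|Ȳ), h⁺ := h(U2|(U1,Ȳ)), and let A_i(ω) := κ_i(Y_i(ω))({0}) where κ_i is a regular conditional distribution of X_i given Y_i. Then almost surely E[h⁻ | σ(Ȳ)] = ℋ(A1∗A2) and E[h⁺ | σ(Ȳ)] = ℋ(A1) + ℋ(A2) − ℋ(A1∗A2). -/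
open MeasureTheory ProbabilityTheory

/-- The conditional entropy random variable `h(X|Y)` of a binary data element `(X,Y)`. -/
noncomputable def entRV {Ω β : Type*} [MeasurableSpace Ω] [MeasurableSpace β]
    (X : Ω → ZMod 2) (Y : Ω → β) (μ : Measure Ω) [IsFiniteMeasure μ] : Ω → ℝ :=
  fun ω => - Real.logb 2 ((condDistrib X Y μ (Y ω)) {X ω}).toReal

lemma zmod2_sum (f : ZMod 2 → ℝ) : ∑ a, f a = f 0 + f 1 := Fin.sum_univ_two f

lemma gen_condExp {Ω β γ : Type*} [MeasurableSpace Ω] [MeasurableSpace β] [MeasurableSpace γ]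
    [Fintype γ] [MeasurableSingletonClass γ] [StandardBorelSpace γ] [Nonempty γ]
    (μ : Measure Ω) [IsProbabilityMeasure μ] (Y : Ω → β) (Z : Ω → γ)
    (hY : Measurable Y) (hZ : Measurable Z) (f : β × γ → ℝ) (hf : Measurable f) (C : ℝ)
    (hC : ∀ᵐ y ∂(μ.map Y), ∀ z, (condDistrib Z Y μ y).real {z} * |f (y, z)| ≤ C) :
    Integrable (fun ω => f (Y ω, Z ω)) μ ∧
    μ[fun ω => f (Y ω, Z ω) | MeasurableSpace.comap Y inferInstance] =ᵐ[μ]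
      fun ω => ∑ z, (condDistrib Z Y μ (Y ω)).real {z} * f (Y ω, z) := by
  have hint : Integrable f (μ.map fun a => (Y a, Z a)) := by
    rw [← AEStronglyMeasurable.ae_integrable_condDistrib_map_iff hZ.aemeasurable
      hf.aestronglyMeasurable]
    refine ⟨Filter.Eventually.of_forall fun a => Integrable.of_finite, ?_⟩
    have := Measure.isProbabilityMeasure_map (μ := μ) hY.aemeasurable
    refine Integrable.of_bound (C := Fintype.card γ * C) ?_ ?_
    · exact (hf.stronglyMeasurable.norm.integral_condDistrib).aestronglyMeasurable
    · filter_upwards [hC] with y hy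
      rw [Real.norm_of_nonneg (integral_nonneg fun _ => norm_nonneg _),
        integral_fintype (Integrable.of_finite)]
      calc _ ≤ ∑ z : γ, C := Finset.sum_le_sum fun z _ => by simpa using hy z
        _ = _ := by simp
  refine ⟨?_, ?_⟩
  · exact (integrable_map_measure hint.1 (hY.prodMk hZ).aemeasurable).mp hint
  · refine (condExp_prod_ae_eq_integral_condDistrib' hY hZ.aemeasurable hint).trans ?_
    refine Filter.Eventually.of_forall fun ω => ?_
    simp only
    rw [integral_fintype (Integrable.of_finite)]
    simp

lemma joint_law {Ω 𝒴₁ 𝒴₂ : Type*} [MeasurableSpace Ω] [MeasurableSpace 𝒴₁] [MeasurableSpace 𝒴₂]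
    (μ : Measure Ω) [IsProbabilityMeasure μ]
    (X₁ X₂ : Ω → ZMod 2) (Y₁ : Ω → 𝒴₁) (Y₂ : Ω → 𝒴₂)
    (hX₁ : Measurable X₁) (hX₂ : Measurable X₂)
    (hY₁ : Measurable Y₁) (hY₂ : Measurable Y₂)
    (hindep : IndepFun (fun ω => (X₁ ω, Y₁ ω)) (fun ω => (X₂ ω, Y₂ ω)) μ) :
    condDistrib (fun ω => (X₁ ω, X₂ ω)) (fun ω => (Y₁ ω, Y₂ ω)) μ
      =ᵐ[μ.map (fun ω => (Y₁ ω, Y₂ ω))] (condDistrib X₁ Y₁ μ) ∥ₖ (condDistrib X₂ Y₂ μ) := by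
  have p1 := Measure.isProbabilityMeasure_map (μ := μ) hY₁.aemeasurable
  have p2 := Measure.isProbabilityMeasure_map (μ := μ) hY₂.aemeasurable
  have i1 : IndepFun Y₁ Y₂ μ := hindep.comp measurable_snd measurable_snd
  have i2 : IndepFun (fun ω => (Y₁ ω, X₁ ω)) (fun ω => (Y₂ ω, X₂ ω)) μ :=
    hindep.comp measurable_swap measurable_swap
  refine condDistrib_ae_eq_of_measure_eq_compProd _ (by fun_prop) ?_
  have e1 : μ.map (fun ω => (Y₁ ω, Y₂ ω)) = (μ.map Y₁).prod (μ.map Y₂) :=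
    (indepFun_iff_map_prod_eq_prod_map_map hY₁.aemeasurable hY₂.aemeasurable).1 i1
  have e2 := (indepFun_iff_map_prod_eq_prod_map_map (hY₁.prodMk hX₁).aemeasurable
    (hY₂.prodMk hX₂).aemeasurable).1 i2
  rw [← compProd_map_condDistrib hX₁.aemeasurable, ← compProd_map_condDistrib hX₂.aemeasurable]
    at e2
  rw [e1]
  refine Measure.ext_of_lintegral _ fun f hf => ?_
  rw [lintegral_map hf (by fun_prop), Measure.lintegral_compProd hf,
    lintegral_prod _ (Measurable.lintegral_kernel_prod_right' hf).aemeasurable]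
  have e3 : ∫⁻ ω, f ((Y₁ ω, Y₂ ω), (X₁ ω, X₂ ω)) ∂μ =
      ∫⁻ p, f ((p.1.1, p.2.1), (p.1.2, p.2.2)) ∂(μ.map fun ω => ((Y₁ ω, X₁ ω), (Y₂ ω, X₂ ω))) := by
    rw [lintegral_map (by fun_prop) (by fun_prop)]
  rw [e3, e2, lintegral_prod _ (by fun_prop), Measure.lintegral_compProd
    (f := fun x : 𝒴₁ × ZMod 2 => ∫⁻ y, f ((x.1, y.1), (x.2, y.2))
      ∂(μ.map Y₂ ⊗ₘ condDistrib X₂ Y₂ μ))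
    (Measurable.lintegral_prod_right' (f := fun p : (𝒴₁ × ZMod 2) × (𝒴₂ × ZMod 2) =>
      f ((p.1.1, p.2.1), (p.1.2, p.2.2))) (by fun_prop))]
  refine lintegral_congr fun y₁ => ?_
  have e4 : ∀ x₁, ∫⁻ y, f ((y₁, y.1), (x₁, y.2)) ∂(μ.map Y₂ ⊗ₘ condDistrib X₂ Y₂ μ)
      = ∫⁻ y₂, ∫⁻ x₂, f ((y₁, y₂), (x₁, x₂)) ∂(condDistrib X₂ Y₂ μ y₂) ∂(μ.map Y₂) := fun x₁ => by
    rw [Measure.lintegral_compProd (by fun_prop)]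
  simp only [e4]
  rw [lintegral_lintegral_swap]
  · refine lintegral_congr fun y₂ => ?_
    rw [Kernel.parallelComp_apply, lintegral_prod _ (by fun_prop)]
  · refine Measurable.aemeasurable ?_
    have := Measurable.lintegral_kernel_prod_right' (κ := (condDistrib X₂ Y₂ μ).comap
      (Prod.snd : ZMod 2 × 𝒴₂ → 𝒴₂) measurable_snd)
      (f := fun p : (ZMod 2 × 𝒴₂) × ZMod 2 => f ((y₁, p.1.2), (p.1.1, p.2))) (by fun_prop)
    exact this

lemma chain_law {Ω β : Type*} [MeasurableSpace Ω] [MeasurableSpace β]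
    (μ : Measure Ω) [IsProbabilityMeasure μ] (U V : Ω → ZMod 2) (Y : Ω → β)
    (hU : Measurable U) (hV : Measurable V) (hY : Measurable Y) :
    condDistrib (fun ω => (U ω, V ω)) Y μ =ᵐ[μ.map Y]
      (condDistrib U Y μ) ⊗ₖ
        ((condDistrib V (fun ω => (U ω, Y ω)) μ).comap Prod.swap measurable_swap) := by
  refine condDistrib_ae_eq_of_measure_eq_compProd _ (by fun_prop) ?_
  refine Measure.ext_of_lintegral _ fun f hf => ?_
  have e1 := compProd_map_condDistrib (μ := μ) (mβ := inferInstance)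
    (X := fun ω => (U ω, Y ω)) hV.aemeasurable
  have e2 := compProd_map_condDistrib (μ := μ) (mβ := inferInstance) (X := Y) hU.aemeasurable
  have e3 : ∫⁻ ω, f (Y ω, (U ω, V ω)) ∂μ =
      ∫⁻ p, f (p.1.2, (p.1.1, p.2)) ∂(μ.map fun ω => ((U ω, Y ω), V ω)) := by
    rw [lintegral_map (by fun_prop) (by fun_prop)]
  have hm : Measurable fun a : ZMod 2 × β =>
      ∫⁻ b, f (a.2, (a.1, b)) ∂(condDistrib V (fun ω => (U ω, Y ω)) μ) a :=
    Measurable.lintegral_kernel_prod_right'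
      (f := fun p : (ZMod 2 × β) × ZMod 2 => f (p.1.2, (p.1.1, p.2))) (by fun_prop)
  rw [lintegral_map hf (by fun_prop), e3, ← e1, Measure.lintegral_compProd (by fun_prop)]
  rw [lintegral_map hm (by fun_prop)]
  have hm' : Measurable fun p : β × ZMod 2 =>
      ∫⁻ b, f (p.1, (p.2, b)) ∂(condDistrib V (fun ω => (U ω, Y ω)) μ) (p.2, p.1) :=
    hm.comp measurable_swap
  have e4 : ∫⁻ ω, ∫⁻ b, f (Y ω, (U ω, b)) ∂(condDistrib V (fun ω => (U ω, Y ω)) μ) (U ω, Y ω) ∂μ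
      = ∫⁻ p, ∫⁻ b, f (p.1, (p.2, b)) ∂(condDistrib V (fun ω => (U ω, Y ω)) μ) (p.2, p.1)
        ∂(μ.map fun ω => (Y ω, U ω)) := by
    rw [lintegral_map hm' (by fun_prop)]
  rw [e4, ← e2, Measure.lintegral_compProd hm',
    Measure.lintegral_compProd hf]
  refine lintegral_congr fun y => ?_
  rw [Kernel.lintegral_compProd _ _ _ (by fun_prop)]
  rfl

lemma bound_aux {p q : ℝ} (h0 : 0 ≤ p) (hpq : p ≤ q) (hq : q ≤ 1) :
    p * |-Real.logb 2 q| ≤ 1 / Real.log 2 := by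
  have hl : 0 < Real.log 2 := Real.log_pos (by norm_num)
  rcases (h0.trans hpq).eq_or_lt with h | h
  · rw [← h]; simp; positivity
  · have h1 := (Real.abs_log_mul_self_lt q h hq).le
    rw [abs_mul, abs_of_pos h] at h1
    rw [abs_neg, Real.logb, abs_div, abs_of_pos hl, ← mul_div_assoc]
    gcongr
    nlinarith [abs_nonneg (Real.log q)]

lemma final_alg (p₁ p₂ q : ZMod 2 → ℝ) (h₁ : p₁ 0 + p₁ 1 = 1) (h₂ : p₂ 0 + p₂ 1 = 1)
    (hq0 : q 0 = p₁ 0 * p₂ 0 + p₁ 1 * p₂ 1) (hq1 : q 1 = p₁ 0 * p₂ 1 + p₁ 1 * p₂ 0) :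
    (∑ z : ZMod 2 × ZMod 2, p₁ z.1 * p₂ z.2 * (-Real.logb 2 (p₁ z.1)) = binH (p₁ 0)) ∧
    (∑ z : ZMod 2 × ZMod 2, p₁ z.1 * p₂ z.2 * (-Real.logb 2 (p₂ z.2)) = binH (p₂ 0)) ∧
    (∑ z : ZMod 2 × ZMod 2, p₁ z.1 * p₂ z.2 * (-Real.logb 2 (q (z.1 + z.2))) =
      binH (pstar (p₁ 0) (p₂ 0))) := by
  have e1 : p₁ 1 = 1 - p₁ 0 := by linarith
  have e2 : p₂ 1 = 1 - p₂ 0 := by linarith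
  have e3 : q 0 = pstar (p₁ 0) (p₂ 0) := by rw [hq0, e1, e2, pstar]
  have e4 : q 1 = 1 - pstar (p₁ 0) (p₂ 0) := by rw [hq1, e1, e2, pstar]; ring
  have e5 : (1 : ZMod 2) + 1 = 0 := rfl
  simp only [Fintype.sum_prod_type, zmod2_sum, zero_add, add_zero, e5, e3, e4, e1, e2, binH]
  refine ⟨by ring, by ring, ?_⟩
  generalize Real.logb 2 (pstar (p₁ 0) (p₂ 0)) = l
  generalize Real.logb 2 (1 - pstar (p₁ 0) (p₂ 0)) = l'
  rw [pstar]; ring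

lemma prob_sum (m : Measure (ZMod 2)) [IsProbabilityMeasure m] : m.real {0} + m.real {1} = 1 := by
  rw [← zmod2_sum (fun a => m.real {a}), sum_measureReal_singleton]
  simp

/-- Conditional expectations of the output entropy random variables of the polar transform
given `σ(Ȳ)`: almost surely `E[h⁻ | σ(Ȳ)] = ℋ(A₁∗A₂)` and
`E[h⁺ | σ(Ȳ)] = ℋ(A₁) + ℋ(A₂) - ℋ(A₁∗A₂)`. -/
theorem condexp_entropy_polar_transform
    {Ω 𝒴₁ 𝒴₂ : Type*} [MeasurableSpace Ω] [MeasurableSpace 𝒴₁] [MeasurableSpace 𝒴₂]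
    (μ : Measure Ω) [IsProbabilityMeasure μ]
    (X₁ X₂ : Ω → ZMod 2) (Y₁ : Ω → 𝒴₁) (Y₂ : Ω → 𝒴₂)
    (hX₁ : Measurable X₁) (hX₂ : Measurable X₂)
    (hY₁ : Measurable Y₁) (hY₂ : Measurable Y₂)
    (hindep : IndepFun (fun ω => (X₁ ω, Y₁ ω)) (fun ω => (X₂ ω, Y₂ ω)) μ)
    (A₁ A₂ : Ω → ℝ)
    (hA₁ : ∀ ω, A₁ ω = ((condDistrib X₁ Y₁ μ (Y₁ ω)) {0}).toReal)
    (hA₂ : ∀ ω, A₂ ω = ((condDistrib X₂ Y₂ μ (Y₂ ω)) {0}).toReal) :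
    (μ[entRV (fun ω => X₁ ω + X₂ ω) (fun ω => (Y₁ ω, Y₂ ω)) μ |
        MeasurableSpace.comap (fun ω => (Y₁ ω, Y₂ ω)) inferInstance]
      =ᵐ[μ] fun ω => binH (pstar (A₁ ω) (A₂ ω)))
    ∧ (μ[entRV X₂ (fun ω => (X₁ ω + X₂ ω, (Y₁ ω, Y₂ ω))) μ |
        MeasurableSpace.comap (fun ω => (Y₁ ω, Y₂ ω)) inferInstance]
      =ᵐ[μ] fun ω => binH (A₁ ω) + binH (A₂ ω) - binH (pstar (A₁ ω) (A₂ ω))) := by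
  have hlaw := joint_law μ X₁ X₂ Y₁ Y₂ hX₁ hX₂ hY₁ hY₂ hindep
  have hY : Measurable (fun ω => (Y₁ ω, Y₂ ω)) := hY₁.prodMk hY₂
  have hZ : Measurable (fun ω => (X₁ ω, X₂ ω)) := hX₁.prodMk hX₂
  have hU : Measurable (fun ω => X₁ ω + X₂ ω) := hX₁.add hX₂
  have hch := chain_law μ (fun ω => X₁ ω + X₂ ω) X₂ (fun ω => (Y₁ ω, Y₂ ω)) hU hX₂ hY
  have hg : Measurable (fun z : ZMod 2 × ZMod 2 => (z.1 + z.2, z.2)) := measurable_of_countable _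
  have hcomp := condDistrib_comp (μ := μ) (mβ := inferInstance) (fun ω => (Y₁ ω, Y₂ ω)) hZ.aemeasurable hg
  have hent : entRV (fun ω => X₁ ω + X₂ ω) (fun ω => (Y₁ ω, Y₂ ω)) μ = fun ω =>
    -Real.logb 2 ((condDistrib (fun ω => X₁ ω + X₂ ω) (fun ω => (Y₁ ω, Y₂ ω)) μ
      (Y₁ ω, Y₂ ω)).real {X₁ ω + X₂ ω}) := rfl
  have hent2 : entRV X₂ (fun ω => (X₁ ω + X₂ ω, (Y₁ ω, Y₂ ω))) μ = fun ω =>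
    -Real.logb 2 ((condDistrib X₂ (fun ω => (X₁ ω + X₂ ω, (Y₁ ω, Y₂ ω))) μ
      (X₁ ω + X₂ ω, (Y₁ ω, Y₂ ω))).real {X₂ ω}) := rfl
  rw [hent, hent2]
  change condDistrib (fun ω => (X₁ ω + X₂ ω, X₂ ω)) (fun ω => (Y₁ ω, Y₂ ω)) μ =ᵐ[_] _ at hcomp
  have hpos : ∀ᵐ ω ∂μ, condDistrib (fun ω => (X₁ ω, X₂ ω)) (fun ω => (Y₁ ω, Y₂ ω)) μ
      (Y₁ ω, Y₂ ω) {(X₁ ω, X₂ ω)} ≠ 0 := by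
    have hm : Measurable (fun p : (𝒴₁ × 𝒴₂) × (ZMod 2 × ZMod 2) =>
        condDistrib (fun ω => (X₁ ω, X₂ ω)) (fun ω => (Y₁ ω, Y₂ ω)) μ p.1 {p.2}) :=
      measurable_from_prod_countable_left fun z => Kernel.measurable_coe _ (measurableSet_singleton z)
    have h1 : ∀ᵐ p ∂(μ.map (fun ω => ((Y₁ ω, Y₂ ω), (X₁ ω, X₂ ω)))),
        condDistrib (fun ω => (X₁ ω, X₂ ω)) (fun ω => (Y₁ ω, Y₂ ω)) μ p.1 {p.2} ≠ 0 := by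
      rw [← compProd_map_condDistrib hZ.aemeasurable]
      refine (Measure.ae_compProd_iff (hm (measurableSet_singleton 0).compl)).2 ?_
      refine Filter.Eventually.of_forall fun y => ?_
      exact ae_iff_of_countable.2 fun x hx => hx
    exact ae_of_ae_map (hY.prodMk hZ).aemeasurable h1
  set K := condDistrib (fun ω => (X₁ ω, X₂ ω)) (fun ω => (Y₁ ω, Y₂ ω)) μ with hKdef
  set κU := condDistrib (fun ω => X₁ ω + X₂ ω) (fun ω => (Y₁ ω, Y₂ ω)) μ with hκU
  set κ' := condDistrib X₂ (fun ω => (X₁ ω + X₂ ω, (Y₁ ω, Y₂ ω))) μ with hκ'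
  set κ₁ := condDistrib X₁ Y₁ μ with hκ₁
  set κ₂ := condDistrib X₂ Y₂ μ with hκ₂
  have hae : ∀ᵐ y ∂(μ.map (fun ω => (Y₁ ω, Y₂ ω))),
      (∀ z, (K y).real {z} = (κ₁ y.1).real {z.1} * (κ₂ y.2).real {z.2}) ∧
      (∀ a b, (κ₁ y.1).real {a} * (κ₂ y.2).real {b} =
        (κU y).real {a + b} * (κ' (a + b, y)).real {b}) := by
    filter_upwards [hlaw, hch, hcomp] with y h1 h2 h3
    have hK : ∀ z, (K y).real {z} = (κ₁ y.1).real {z.1} * (κ₂ y.2).real {z.2} := by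
      rintro ⟨a, b⟩
      rw [measureReal_def, h1, Kernel.parallelComp_apply, ← Set.singleton_prod_singleton,
        Measure.prod_prod, ENNReal.toReal_mul]
      rfl
    refine ⟨hK, fun a b => ?_⟩
    have hK' := hK (a, b)
    simp only at hK'
    rw [← hK']
    rw [h2] at h3
    have h4 := congrArg (fun m => m {(a + b, b)}) h3
    have hpre : (fun z : ZMod 2 × ZMod 2 => (z.1 + z.2, z.2)) ⁻¹' {(a + b, b)} = {(a, b)} := by
      ext ⟨c, d⟩
      simp only [Set.mem_preimage, Set.mem_singleton_iff, Prod.mk.injEq]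
      constructor
      · rintro ⟨h, rfl⟩
        exact ⟨add_right_cancel h, rfl⟩
      · rintro ⟨rfl, rfl⟩
        exact ⟨rfl, rfl⟩
    rw [Kernel.map_apply' _ hg _ (measurableSet_singleton _), hpre,
      ← Set.singleton_prod_singleton, Kernel.compProd_apply_prod (measurableSet_singleton _)
        (measurableSet_singleton _), Measure.restrict_singleton, lintegral_smul_measure,
      lintegral_dirac, Kernel.comap_apply] at h4
    rw [measureReal_def, ← h4, smul_eq_mul, ENNReal.toReal_mul]
    rfl
  have hle : ∀ {γ : Type} [MeasurableSpace γ] (m : Measure γ) [IsProbabilityMeasure m] (s : Set γ),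
      m.real s ≤ 1 := fun m _ s => measureReal_le_one
  have mlog : Measurable (Real.logb 2) := Real.measurable_log.div_const _
  obtain ⟨I1, E1⟩ := gen_condExp μ _ _ hY hZ
    (fun p => -Real.logb 2 ((κ₁ p.1.1).real {p.2.1}))
    (measurable_from_prod_countable_left fun z => (mlog.comp
      (((Kernel.measurable_coe κ₁ (measurableSet_singleton z.1)).ennreal_toReal).comp
        measurable_fst)).neg) (1 / Real.log 2) (by
      filter_upwards [hae] with y hy z
      rw [← hKdef, hy.1 z]
      exact bound_aux (by positivity) (mul_le_of_le_one_right (by positivity) (hle _ _)) (hle _ _))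
  obtain ⟨I2, E2⟩ := gen_condExp μ _ _ hY hZ
    (fun p => -Real.logb 2 ((κ₂ p.1.2).real {p.2.2}))
    (measurable_from_prod_countable_left fun z => (mlog.comp
      (((Kernel.measurable_coe κ₂ (measurableSet_singleton z.2)).ennreal_toReal).comp
        measurable_snd)).neg) (1 / Real.log 2) (by
      filter_upwards [hae] with y hy z
      rw [← hKdef, hy.1 z]
      exact bound_aux (by positivity) (mul_le_of_le_one_left (by positivity) (hle _ _)) (hle _ _))
  obtain ⟨I3, E3⟩ := gen_condExp μ _ _ hY hZ
    (fun p => -Real.logb 2 ((κU p.1).real {p.2.1 + p.2.2}))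
    (measurable_from_prod_countable_left fun z => (mlog.comp
      ((Kernel.measurable_coe κU (measurableSet_singleton (z.1 + z.2))).ennreal_toReal)).neg)
    (1 / Real.log 2) (by
      filter_upwards [hae] with y hy z
      rw [← hKdef, hy.1 z]
      refine bound_aux (by positivity) ?_ (hle _ _)
      rw [hy.2]
      exact mul_le_of_le_one_right (by positivity) (hle _ _))
  simp only at I1 I2 I3 E1 E2 E3
  have haeω := ae_of_ae_map hY.aemeasurable hae
  have hfin : ∀ᵐ ω ∂μ,
      (∑ z, (K (Y₁ ω, Y₂ ω)).real {z} * (-Real.logb 2 ((κ₁ (Y₁ ω)).real {z.1})) = binH (A₁ ω)) ∧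
      (∑ z, (K (Y₁ ω, Y₂ ω)).real {z} * (-Real.logb 2 ((κ₂ (Y₂ ω)).real {z.2})) = binH (A₂ ω)) ∧
      (∑ z, (K (Y₁ ω, Y₂ ω)).real {z} *
        (-Real.logb 2 ((κU (Y₁ ω, Y₂ ω)).real {z.1 + z.2})) = binH (pstar (A₁ ω) (A₂ ω))) := by
    filter_upwards [haeω] with ω hω
    obtain ⟨h1, h2⟩ := hω
    simp only [h1, hA₁, hA₂]
    have s0 := prob_sum (κ' (0, (Y₁ ω, Y₂ ω)))
    have s1 := prob_sum (κ' (1, (Y₁ ω, Y₂ ω)))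
    have h00 := h2 0 0
    have h01 := h2 0 1
    have h10 := h2 1 0
    have h11 := h2 1 1
    have e5 : (1 : ZMod 2) + 1 = 0 := rfl
    simp only [zero_add, add_zero, e5] at h00 h01 h10 h11
    refine final_alg (fun a => (κ₁ (Y₁ ω)).real {a}) (fun a => (κ₂ (Y₂ ω)).real {a})
      (fun a => (κU (Y₁ ω, Y₂ ω)).real {a}) (prob_sum _) (prob_sum _) ?_ ?_
    · rw [h00, h11, ← mul_add, s0, mul_one]
    · rw [h01, h10, ← mul_add, add_comm (Measure.real _ {(1 : ZMod 2)}), s1, mul_one]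
  refine ⟨?_, ?_⟩
  · filter_upwards [E3, hfin] with ω h1 h2
    rw [h1, ← h2.2.2]
  · have hsum : (fun ω => -Real.logb 2 ((κ' (X₁ ω + X₂ ω, (Y₁ ω, Y₂ ω))).real {X₂ ω})) =ᵐ[μ]
      ((fun ω => -Real.logb 2 ((κ₁ (Y₁ ω)).real {X₁ ω})) +
       (fun ω => -Real.logb 2 ((κ₂ (Y₂ ω)).real {X₂ ω}))) -
       (fun ω => -Real.logb 2 ((κU (Y₁ ω, Y₂ ω)).real {X₁ ω + X₂ ω})) := by
      filter_upwards [haeω, hpos] with ω h1 h2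
      have h3 : (K (Y₁ ω, Y₂ ω)).real {(X₁ ω, X₂ ω)} ≠ 0 :=
        ENNReal.toReal_ne_zero.2 ⟨h2, measure_ne_top _ _⟩
      have h4 := h1.2 (X₁ ω) (X₂ ω)
      rw [h1.1] at h3
      simp only at h3 h4
      have h5 := h3
      rw [h4] at h5
      have h6 := congrArg (Real.logb 2) h4
      rw [Real.logb_mul (left_ne_zero_of_mul h3) (right_ne_zero_of_mul h3),
        Real.logb_mul (left_ne_zero_of_mul h5) (right_ne_zero_of_mul h5)] at h6
      simp only [Pi.add_apply, Pi.sub_apply]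
      linarith
    refine (condExp_congr_ae hsum).trans ?_
    filter_upwards [E1, E2, E3, hfin, condExp_sub (I1.add I2) I3
      (MeasurableSpace.comap (fun ω => (Y₁ ω, Y₂ ω)) inferInstance), condExp_add I1 I2
      (MeasurableSpace.comap (fun ω => (Y₁ ω, Y₂ ω)) inferInstance)] with ω h1 h2 h3 h4 h5 h6
    rw [h5, Pi.sub_apply, h6, Pi.add_apply, h1, h2, h3, ← h4.1, ← h4.2.1, ← h4.2.2]
end

section
/- The map F ↦ C(F) is continuous on the space of Borel probability measures on [0,1] equipped with the topology of weak convergence (convergence in distribution). In particular, if F_n ⇒ F₀ weakly, then C(F_n) → C(F₀), and moreover F_n⁻ ⇒ F₀⁻ and F_n⁺ ⇒ F₀⁺ weakly. -/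
open MeasureTheory

/-- `ℋ₂(p) = p (log₂ p)² + (1-p) (log₂ (1-p))²`. -/
noncomputable def binH2 (p : ℝ) : ℝ :=
  p * (Real.logb 2 p) ^ 2 + (1 - p) * (Real.logb 2 (1 - p)) ^ 2

/-- `(a₁,a₂) ↦ a₁∗a₂` as a map `[0,1]² → [0,1]`. -/
noncomputable def starMap (x : Set.Icc (0:ℝ) 1 × Set.Icc (0:ℝ) 1) : Set.Icc (0:ℝ) 1 :=
  ⟨pstar x.1 x.2, by
    obtain ⟨⟨p, hp0, hp1⟩, ⟨q, hq0, hq1⟩⟩ := x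
    constructor <;> · simp only [pstar]; nlinarith⟩

/-- `(a₁,a₂) ↦ a₁a₂/(a₁∗a₂)` as a map `[0,1]² → [0,1]` (value `0` where the
denominator vanishes, by the Lean convention `x / 0 = 0`). -/
noncomputable def plusMap₁ (x : Set.Icc (0:ℝ) 1 × Set.Icc (0:ℝ) 1) : Set.Icc (0:ℝ) 1 :=
  ⟨(x.1 : ℝ) * (x.2 : ℝ) / pstar x.1 x.2, by
    obtain ⟨⟨p, hp0, hp1⟩, ⟨q, hq0, hq1⟩⟩ := x
    have h0 : (0:ℝ) ≤ pstar p q := by simp only [pstar]; nlinarith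
    refine ⟨div_nonneg (by nlinarith) h0, div_le_one_of_le₀ ?_ h0⟩
    simp only [pstar]; nlinarith⟩

/-- `(a₁,a₂) ↦ (1-a₁)a₂/((1-a₁)∗a₂)` as a map `[0,1]² → [0,1]`. -/
noncomputable def plusMap₂ (x : Set.Icc (0:ℝ) 1 × Set.Icc (0:ℝ) 1) : Set.Icc (0:ℝ) 1 :=
  ⟨(1 - (x.1 : ℝ)) * (x.2 : ℝ) / pstar (1 - (x.1 : ℝ)) x.2, by
    obtain ⟨⟨p, hp0, hp1⟩, ⟨q, hq0, hq1⟩⟩ := x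
    have h0 : (0:ℝ) ≤ pstar (1 - p) q := by simp only [pstar]; nlinarith
    refine ⟨div_nonneg (by nlinarith) h0, div_le_one_of_le₀ ?_ h0⟩
    simp only [pstar]; nlinarith⟩

/-- The varentropy functional `V(F) = ∫ℋ₂ dF - (∫ℋ dF)²` of a measure on `[0,1]`. -/
noncomputable def VF (F : Measure (Set.Icc (0:ℝ) 1)) : ℝ :=
  (∫ a, binH2 (a : ℝ) ∂F) - (∫ a, binH (a : ℝ) ∂F) ^ 2

/-- `F⁻`: the pushforward of `F × F` under `(a₁,a₂) ↦ a₁∗a₂`. -/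
noncomputable def Fminus (F : Measure (Set.Icc (0:ℝ) 1)) : Measure (Set.Icc (0:ℝ) 1) :=
  (F.prod F).map starMap

/-- `F⁺`: the sum of the pushforward under `(a₁,a₂) ↦ a₁a₂/(a₁∗a₂)` of the measure with
density `a₁∗a₂` w.r.t. `F × F`, and the pushforward under `(a₁,a₂) ↦ (1-a₁)a₂/((1-a₁)∗a₂)`
of the measure with density `(1-a₁)∗a₂` w.r.t. `F × F`. -/
noncomputable def Fplus (F : Measure (Set.Icc (0:ℝ) 1)) : Measure (Set.Icc (0:ℝ) 1) :=
  ((F.prod F).withDensity (fun x => ENNReal.ofReal (pstar x.1 x.2))).map plusMap₁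
    + ((F.prod F).withDensity
        (fun x => ENNReal.ofReal (pstar (1 - (x.1 : ℝ)) x.2))).map plusMap₂

/-- `C(F) = V(F) - (V(F⁻) + V(F⁺))/2`. -/
noncomputable def CF (F : Measure (Set.Icc (0:ℝ) 1)) : ℝ :=
  VF F - (VF (Fminus F) + VF (Fplus F)) / 2


/-- The unit interval as used in the statement. -/
abbrev UI : Type := Set.Icc (0:ℝ) 1

lemma cont_mul_logb_sq {X : Type*} [TopologicalSpace X] (f : X → ℝ) (hf : Continuous f)
    (h0 : ∀ x, 0 ≤ f x) : Continuous (fun x => f x * (Real.logb 2 (f x)) ^ 2) := by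
  have h : (fun x => f x * (Real.logb 2 (f x)) ^ 2) =
      fun x => (Real.sqrt (f x) * Real.log (Real.sqrt (f x))) ^ 2 * (4 / (Real.log 2) ^ 2) := by
    funext x
    rw [Real.log_sqrt (h0 x), mul_pow, Real.sq_sqrt (h0 x), Real.logb]
    ring
  rw [h]
  exact ((Real.continuous_mul_log.comp (Real.continuous_sqrt.comp hf)).pow 2).mul continuous_const

lemma cont_mul_logb {X : Type*} [TopologicalSpace X] (f : X → ℝ) (hf : Continuous f) :
    Continuous (fun x => f x * Real.logb 2 (f x)) := by
  have h : (fun x => f x * Real.logb 2 (f x)) =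
      fun x => (f x * Real.log (f x)) / Real.log 2 := by
    funext x
    rw [Real.logb]
    ring
  rw [h]
  exact (Real.continuous_mul_log.comp hf).div_const _

lemma cont_binH : Continuous (fun a : UI => binH (a : ℝ)) := by
  unfold binH
  exact (cont_mul_logb _ continuous_subtype_val).neg.sub
    (cont_mul_logb (fun a : UI => 1 - (a : ℝ)) (continuous_const.sub continuous_subtype_val))

lemma cont_binH2 : Continuous (fun a : UI => binH2 (a : ℝ)) := by
  unfold binH2
  exact (cont_mul_logb_sq _ continuous_subtype_val fun x => x.2.1).add
    (cont_mul_logb_sq (fun a : UI => 1 - (a : ℝ)) (continuous_const.sub continuous_subtype_val)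
      fun x => sub_nonneg.2 x.2.2)

/-- Multiplying by a vanishing weight removes the discontinuities of the quotient map. -/
lemma cont_weight {X : Type*} [TopologicalSpace X] (g : UI → ℝ) (hg : Continuous g)
    (w : X → ℝ) (hw : Continuous w) (m : X → UI)
    (hm : ∀ x, w x ≠ 0 → ContinuousAt m x) : Continuous (fun x => w x * g (m x)) := by
  refine continuous_iff_continuousAt.2 fun x => ?_
  by_cases hx : w x = 0
  · obtain ⟨C, hC⟩ := isCompact_univ.exists_bound_of_continuousOn hg.continuousOn
    have h0 : Filter.Tendsto (fun y => |w y| * C) (nhds x) (nhds 0) := by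
      have : Continuous (fun y => |w y| * C) := by fun_prop
      simpa [hx] using this.tendsto x
    unfold ContinuousAt
    simp only [hx, zero_mul]
    refine squeeze_zero_norm (fun y => ?_) h0
    rw [norm_mul, Real.norm_eq_abs]
    exact mul_le_mul_of_nonneg_left (hC _ trivial) (abs_nonneg _)
  · exact hw.continuousAt.mul (hg.continuousAt.comp (hm x hx))

lemma cont_w1 : Continuous (fun x : UI × UI => pstar (x.1 : ℝ) (x.2 : ℝ)) := by
  unfold pstar; fun_prop

lemma cont_w2 : Continuous (fun x : UI × UI => pstar (1 - (x.1 : ℝ)) (x.2 : ℝ)) := by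
  unfold pstar; fun_prop

lemma nonneg_w1 (x : UI × UI) : 0 ≤ pstar (x.1 : ℝ) (x.2 : ℝ) := (starMap x).2.1

lemma nonneg_w2 (x : UI × UI) : 0 ≤ pstar (1 - (x.1 : ℝ)) (x.2 : ℝ) := by
  obtain ⟨⟨p, hp0, hp1⟩, ⟨q, hq0, hq1⟩⟩ := x
  simp only [pstar]; nlinarith

lemma cont_starMap : Continuous starMap := cont_w1.subtype_mk _

lemma contAt_plus1 (x : UI × UI) (hx : pstar (x.1 : ℝ) (x.2 : ℝ) ≠ 0) :
    ContinuousAt plusMap₁ x := by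
  refine Topology.IsInducing.subtypeVal.continuousAt_iff.2 ?_
  have h1 : Continuous (fun x : UI × UI => (x.1 : ℝ) * (x.2 : ℝ)) := by fun_prop
  exact h1.continuousAt.div cont_w1.continuousAt hx

lemma contAt_plus2 (x : UI × UI) (hx : pstar (1 - (x.1 : ℝ)) (x.2 : ℝ) ≠ 0) :
    ContinuousAt plusMap₂ x := by
  refine Topology.IsInducing.subtypeVal.continuousAt_iff.2 ?_
  have h1 : Continuous (fun x : UI × UI => (1 - (x.1 : ℝ)) * (x.2 : ℝ)) := by fun_prop
  exact h1.continuousAt.div cont_w2.continuousAt hx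

lemma meas_plus1 : Measurable plusMap₁ := by
  refine Measurable.subtype_mk ?_
  have h1 : Continuous (fun x : UI × UI => (x.1 : ℝ) * (x.2 : ℝ)) := by fun_prop
  exact h1.measurable.div cont_w1.measurable

lemma meas_plus2 : Measurable plusMap₂ := by
  refine Measurable.subtype_mk ?_
  have h1 : Continuous (fun x : UI × UI => (1 - (x.1 : ℝ)) * (x.2 : ℝ)) := by fun_prop
  exact h1.measurable.div cont_w2.measurable

lemma cont_integral {X : Type*} [TopologicalSpace X] [CompactSpace X] [MeasurableSpace X]
    [OpensMeasurableSpace X] (g : X → ℝ) (hg : Continuous g) :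
    Continuous (fun F : ProbabilityMeasure X => ∫ x, g x ∂(F : Measure X)) :=
  ProbabilityMeasure.continuous_integral_boundedContinuousFunction
    (BoundedContinuousFunction.mkOfCompact ⟨g, hg⟩)

lemma cont_integral_prod (g : UI × UI → ℝ) (hg : Continuous g) :
    Continuous (fun F : ProbabilityMeasure UI =>
      ∫ x, g x ∂((F : Measure UI).prod (F : Measure UI))) :=
  (cont_integral g hg).comp
    (ProbabilityMeasure.continuous_prod.comp (continuous_id.prodMk continuous_id))

lemma cont_minus (g : UI → ℝ) (hg : Continuous g) :
    Continuous (fun F : ProbabilityMeasure UI => ∫ x, g x ∂(Fminus (F : Measure UI))) := by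
  have h : (fun F : ProbabilityMeasure UI => ∫ x, g x ∂(Fminus (F : Measure UI))) =
      fun F : ProbabilityMeasure UI => ∫ x, g (starMap x) ∂((F : Measure UI).prod (F : Measure UI)) := by
    funext F
    exact integral_map cont_starMap.measurable.aemeasurable hg.aestronglyMeasurable
  rw [h]
  exact cont_integral_prod _ (hg.comp cont_starMap)

lemma integrable_push (g : UI → ℝ) (hg : Continuous g) (μ : Measure (UI × UI))
    [IsFiniteMeasure μ] (w : UI × UI → ℝ) (hw : Continuous w) (m : UI × UI → UI) :
    Integrable g ((μ.withDensity (fun x => ENNReal.ofReal (w x))).map m) := by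
  obtain ⟨C, hC⟩ := isCompact_univ.exists_bound_of_continuousOn hg.continuousOn
  obtain ⟨D, hD⟩ := isCompact_univ.exists_bound_of_continuousOn hw.continuousOn
  have hint : Integrable w μ :=
    Integrable.of_bound hw.aestronglyMeasurable D (Filter.Eventually.of_forall fun x => hD x trivial)
  have := isFiniteMeasure_withDensity_ofReal hint.2
  exact Integrable.of_bound hg.aestronglyMeasurable C
    (Filter.Eventually.of_forall fun x => hC x trivial)

lemma integral_push (g : UI → ℝ) (hg : Continuous g) (μ : Measure (UI × UI))
    (w : UI × UI → ℝ) (hw : Continuous w) (h0 : ∀ x, 0 ≤ w x) (m : UI × UI → UI)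
    (hm : Measurable m) :
    ∫ x, g x ∂((μ.withDensity (fun x => ENNReal.ofReal (w x))).map m) =
      ∫ x, w x * g (m x) ∂μ := by
  rw [integral_map hm.aemeasurable hg.aestronglyMeasurable,
    integral_withDensity_eq_integral_toReal_smul hw.measurable.ennreal_ofReal
      (Filter.Eventually.of_forall fun x => ENNReal.ofReal_lt_top)]
  refine integral_congr_ae (Filter.Eventually.of_forall fun x => ?_)
  simp only [ENNReal.toReal_ofReal (h0 x), smul_eq_mul]

lemma cont_plus (g : UI → ℝ) (hg : Continuous g) :
    Continuous (fun F : ProbabilityMeasure UI => ∫ x, g x ∂(Fplus (F : Measure UI))) := by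
  have h : (fun F : ProbabilityMeasure UI => ∫ x, g x ∂(Fplus (F : Measure UI))) =
      fun F : ProbabilityMeasure UI => (∫ x : UI × UI, pstar (x.1 : ℝ) (x.2 : ℝ) * g (plusMap₁ x)
          ∂((F : Measure UI).prod (F : Measure UI)))
        + ∫ x : UI × UI, pstar (1 - (x.1 : ℝ)) (x.2 : ℝ) * g (plusMap₂ x)
          ∂((F : Measure UI).prod (F : Measure UI)) := by
    funext F
    unfold Fplus
    rw [integral_add_measure (integrable_push g hg _ _ cont_w1 _)
      (integrable_push g hg _ _ cont_w2 _),
      integral_push g hg _ _ cont_w1 nonneg_w1 _ meas_plus1,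
      integral_push g hg _ _ cont_w2 nonneg_w2 _ meas_plus2]
  rw [h]
  exact (cont_integral_prod _ (cont_weight g hg _ cont_w1 _ contAt_plus1)).add
    (cont_integral_prod _ (cont_weight g hg _ cont_w2 _ contAt_plus2))

lemma cont_CF : Continuous (fun F : ProbabilityMeasure UI => CF (F : Measure UI)) := by
  unfold CF VF
  exact ((cont_integral _ cont_binH2).sub ((cont_integral _ cont_binH).pow 2)).sub
    ((((cont_minus _ cont_binH2).sub ((cont_minus _ cont_binH).pow 2)).add
      ((cont_plus _ cont_binH2).sub ((cont_plus _ cont_binH).pow 2))).div_const 2)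


/-- The map `F ↦ C(F)` is continuous for the topology of weak convergence on probability
measures on `[0,1]`; in particular if `Fₙ ⇒ F₀` weakly then `C(Fₙ) → C(F₀)`, and moreover
`Fₙ⁻ ⇒ F₀⁻` and `Fₙ⁺ ⇒ F₀⁺` weakly (tested against bounded continuous functions). -/
theorem CF_continuous :
    Continuous (fun F : ProbabilityMeasure (Set.Icc (0:ℝ) 1) => CF (F : Measure (Set.Icc (0:ℝ) 1)))
    ∧ ∀ (F : ℕ → ProbabilityMeasure (Set.Icc (0:ℝ) 1))
        (F₀ : ProbabilityMeasure (Set.Icc (0:ℝ) 1)),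
        Filter.Tendsto F Filter.atTop (nhds F₀) →
        (Filter.Tendsto (fun n => CF (F n : Measure (Set.Icc (0:ℝ) 1))) Filter.atTop
            (nhds (CF (F₀ : Measure (Set.Icc (0:ℝ) 1))))
        ∧ (∀ g : BoundedContinuousFunction (Set.Icc (0:ℝ) 1) ℝ,
            Filter.Tendsto (fun n => ∫ x, g x ∂(Fminus (F n : Measure (Set.Icc (0:ℝ) 1))))
              Filter.atTop (nhds (∫ x, g x ∂(Fminus (F₀ : Measure (Set.Icc (0:ℝ) 1))))))
        ∧ (∀ g : BoundedContinuousFunction (Set.Icc (0:ℝ) 1) ℝ,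
            Filter.Tendsto (fun n => ∫ x, g x ∂(Fplus (F n : Measure (Set.Icc (0:ℝ) 1))))
              Filter.atTop (nhds (∫ x, g x ∂(Fplus (F₀ : Measure (Set.Icc (0:ℝ) 1))))))) := by
  exact ⟨cont_CF, fun F F₀ hF => ⟨(cont_CF.tendsto F₀).comp hF,
    fun g => ((cont_minus g g.continuous).tendsto F₀).comp hF,
    fun g => ((cont_plus g g.continuous).tendsto F₀).comp hF⟩⟩
end

section
/- For every δ > 0 there exists Δ > 0 such that C(F) ≥ Δ for every Borel probability measure F on [0,1] with V(F) ≥ δ; equivalently, inf{ C(F) : F a Borel probability measure on [0,1] with V(F) ≥ δ } > 0. -/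
open MeasureTheory

namespace PolarAux

local notation "𝕀" => Set.Icc (0:ℝ) 1

lemma binH_eq (p : ℝ) : binH p = Real.binEntropy p / Real.log 2 := by
  simp only [binH, Real.binEntropy, Real.logb, Real.log_inv]; ring

lemma log2_pos : 0 < Real.log 2 := Real.log_pos (by norm_num)

lemma binH_cont : Continuous binH := by
  have : binH = fun p => Real.binEntropy p / Real.log 2 := funext binH_eq
  rw [this]; fun_prop

lemma binH_symm (p : ℝ) : binH (1 - p) = binH p := by simp [binH_eq]

/-- entropy depends on the distance to one half -/
lemma binH_fold (p : ℝ) : binH p = binH (1/2 - |p - 1/2|) := by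
  rcases abs_cases (p - 1/2) with ⟨h, _⟩ | ⟨h, _⟩
  · rw [h, ← binH_symm p]; ring_nf
  · rw [h]; ring_nf

lemma binH_lt {p q : ℝ} (hp : |p - 1/2| ≤ 1/2)
    (h : |q - 1/2| < |p - 1/2|) : binH p < binH q := by
  rw [binH_fold p, binH_fold q, binH_eq, binH_eq]
  have := abs_nonneg (q - 1/2)
  have := abs_nonneg (p - 1/2)
  apply div_lt_div_of_pos_right _ log2_pos
  apply Real.binEntropy_strictMonoOn
  · constructor <;> norm_num <;> linarith
  · constructor <;> norm_num <;> linarith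
  · linarith

lemma binH_le {p q : ℝ} (hp : |p - 1/2| ≤ 1/2)
    (h : |q - 1/2| ≤ |p - 1/2|) : binH p ≤ binH q := by
  rcases h.lt_or_eq with h | h
  · exact (binH_lt hp h).le
  · rw [binH_fold p, binH_fold q, h]

lemma binH_nonneg {p : ℝ} (h : p ∈ 𝕀) : 0 ≤ binH p := by
  rw [binH_eq]; exact div_nonneg (Real.binEntropy_nonneg h.1 h.2) log2_pos.le

lemma binH_le_one {p : ℝ} : binH p ≤ 1 := by
  rw [binH_eq, div_le_one log2_pos]; exact Real.binEntropy_le_log_two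

lemma dist_half {p : ℝ} (h : p ∈ 𝕀) : |p - 1/2| ≤ 1/2 := by
  rw [abs_le]; constructor <;> linarith [h.1, h.2]

lemma pstar_half (p q : ℝ) : |pstar p q - 1/2| = 2 * |p - 1/2| * |q - 1/2| := by
  have : pstar p q - 1/2 = 2 * (p - 1/2) * (q - 1/2) := by simp only [pstar]; ring
  rw [this, abs_mul, abs_mul]; norm_num

lemma pstar_mem {p q : ℝ} (hp : p ∈ 𝕀) (hq : q ∈ 𝕀) : pstar p q ∈ 𝕀 :=
  (starMap (⟨p, hp⟩, ⟨q, hq⟩)).2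

lemma one_sub_mem {p : ℝ} (hp : p ∈ 𝕀) : 1 - p ∈ 𝕀 :=
  ⟨by linarith [hp.2], by linarith [hp.1]⟩

lemma pstar_one_sub (p q : ℝ) : pstar (1 - p) q = 1 - pstar p q := by
  simp only [pstar]; ring

lemma G_mono {a a' c : ℝ} (ha : a ∈ 𝕀) (hc : c ∈ 𝕀)
    (h : |a' - 1/2| ≤ |a - 1/2|) : binH (pstar a c) ≤ binH (pstar a' c) := by
  apply binH_le (dist_half (pstar_mem ha hc))
  rw [pstar_half, pstar_half]
  gcongr

lemma K_mono_aux {c : ℝ} (hc : 1/2 ≤ c) (hc1 : c ≤ 1) :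
    MonotoneOn (fun t => Real.binEntropy t - Real.binEntropy (pstar t c)) (Set.Icc 0 (1/2)) := by
  have hd : ∀ x ∈ Set.Ioo (0:ℝ) (1/2), HasDerivAt
      (fun t => Real.binEntropy t - Real.binEntropy (pstar t c))
      ((Real.log (1 - x) - Real.log x)
        - (Real.log (1 - pstar x c) - Real.log (pstar x c)) * (2 * c - 1)) x ∧
      x ≤ pstar x c ∧ pstar x c ≤ 1/2 := by
    intro x hx
    have h1 : x ≤ pstar x c := by simp only [pstar]; nlinarith [hx.1, hx.2]
    have h2 : pstar x c ≤ 1/2 := by simp only [pstar]; nlinarith [hx.1, hx.2]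
    refine ⟨?_, h1, h2⟩
    have hs : HasDerivAt (fun t => pstar t c) (2 * c - 1) x := by
      have : (fun t => pstar t c) = fun t => t * (2 * c - 1) + (1 - c) := by
        ext t; simp only [pstar]; ring
      rw [this]
      simpa using ((hasDerivAt_id x).mul_const (2 * c - 1)).add_const (1 - c)
    have e1 := Real.hasDerivAt_binEntropy (p := x) hx.1.ne' (by linarith [hx.2])
    have e2 := Real.hasDerivAt_binEntropy (p := pstar x c)
      (by linarith [hx.1]) (by linarith [hx.2])
    have e3 : HasDerivAt (fun t => Real.binEntropy (pstar t c))
        ((Real.log (1 - pstar x c) - Real.log (pstar x c)) * (2 * c - 1)) x :=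
      HasDerivAt.comp (h₂ := Real.binEntropy) (h := fun t => pstar t c) x e2 hs
    exact e1.sub e3
  apply monotoneOn_of_deriv_nonneg (convex_Icc _ _)
  · apply Continuous.continuousOn
    unfold pstar
    fun_prop
  · rw [interior_Icc]
    intro x hx
    exact (hd x hx).1.differentiableAt.differentiableWithinAt
  · rw [interior_Icc]
    intro x hx
    obtain ⟨h, h1, h2⟩ := hd x hx
    rw [h.deriv]
    have l1 : Real.log x ≤ Real.log (pstar x c) := Real.log_le_log hx.1 h1
    have l2 : Real.log (1 - pstar x c) ≤ Real.log (1 - x) :=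
      Real.log_le_log (by linarith) (by linarith)
    have l3 : Real.log (pstar x c) ≤ Real.log (1 - pstar x c) :=
      Real.log_le_log (by linarith [hx.1]) (by linarith)
    nlinarith

lemma K_mono {a a' c : ℝ} (ha : a ∈ 𝕀) (hc : c ∈ 𝕀)
    (h : |a' - 1/2| ≤ |a - 1/2|) :
    binH a - binH (pstar a c) ≤ binH a' - binH (pstar a' c) := by
  have key : ∀ x : ℝ, binH x - binH (pstar x c) =
      (Real.binEntropy (1/2 - |x - 1/2|)
        - Real.binEntropy (pstar (1/2 - |x - 1/2|) (1/2 + |c - 1/2|))) / Real.log 2 := by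
    intro x
    have : binH (pstar x c) = binH (pstar (1/2 - |x - 1/2|) (1/2 + |c - 1/2|)) := by
      rw [binH_fold (pstar x c), binH_fold (pstar (1/2 - |x - 1/2|) (1/2 + |c - 1/2|)),
        pstar_half, pstar_half]
      simp
    rw [this, binH_fold x, binH_eq, binH_eq]; ring
  rw [key, key]
  have h0 := abs_nonneg (c - 1/2)
  have h1 := dist_half hc
  have h2 := dist_half ha
  have h3 := abs_nonneg (a' - 1/2)
  have := K_mono_aux (c := 1/2 + |c - 1/2|) (by linarith) (by linarith)
    (a := 1/2 - |a - 1/2|) ⟨by linarith, by linarith⟩ (b := 1/2 - |a' - 1/2|)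
    ⟨by linarith, by linarith⟩ (by linarith)
  exact div_le_div_of_nonneg_right this log2_pos.le

/-- posterior after observing the sum -/
noncomputable def bP (x y : ℝ) : ℝ := x * y / pstar x y

noncomputable def T1 (x y : ℝ) : ℝ :=
  -(pstar x y * Real.logb 2 (pstar x y)) * binH (bP x y)

noncomputable def Q (u v : ℝ) : ℝ := u * v * (Real.logb 2 u + Real.logb 2 v) ^ 2

lemma bP_mem {x y : ℝ} (hx : x ∈ 𝕀) (hy : y ∈ 𝕀) : bP x y ∈ 𝕀 :=
  (plusMap₁ (⟨x, hx⟩, ⟨y, hy⟩)).2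

lemma s_mul_b {x y : ℝ} (hx : x ∈ 𝕀) (hy : y ∈ 𝕀) :
    pstar x y * bP x y = x * y ∧ pstar x y * (1 - bP x y) = (1 - x) * (1 - y) := by
  have h1 : pstar x y * bP x y = x * y := by
    by_cases h : pstar x y = 0
    · have a1 : 0 ≤ x * y := mul_nonneg hx.1 hy.1
      have a2 : 0 ≤ (1 - x) * (1 - y) := mul_nonneg (one_sub_mem hx).1 (one_sub_mem hy).1
      have : x * y = 0 := by simp only [pstar] at h; linarith
      rw [h, this]; ring
    · simp only [bP]; field_simp
  refine ⟨h1, ?_⟩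
  rw [mul_sub, h1]; simp only [pstar]; ring

lemma log_id {s b x y : ℝ} (h : s * b = x * y) :
    s * b * (Real.logb 2 s + Real.logb 2 b) = x * y * (Real.logb 2 x + Real.logb 2 y) ∧
    s * b * (Real.logb 2 s + Real.logb 2 b) ^ 2
      = x * y * (Real.logb 2 x + Real.logb 2 y) ^ 2 := by
  by_cases h0 : x * y = 0
  · simp [h, h0]
  · have h1 : s * b ≠ 0 := by rwa [h]
    have e : Real.logb 2 s + Real.logb 2 b = Real.logb 2 x + Real.logb 2 y := by
      rw [← Real.logb_mul (left_ne_zero_of_mul h1) (right_ne_zero_of_mul h1),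
        ← Real.logb_mul (left_ne_zero_of_mul h0) (right_ne_zero_of_mul h0), h]
    rw [e, h]; simp

lemma ident2 {x y : ℝ} (hx : x ∈ 𝕀) (hy : y ∈ 𝕀) :
    pstar x y * binH2 (bP x y) = Q x y + Q (1 - x) (1 - y) -
      pstar x y * (Real.logb 2 (pstar x y)) ^ 2 - 2 * T1 x y := by
  obtain ⟨h1, h2⟩ := s_mul_b hx hy
  have e1 := (log_id h1).2
  have e2 := (log_id h2).2
  simp only [Q, T1, binH2, binH]
  linear_combination e1 + e2

lemma ident1 {x y : ℝ} (hx : x ∈ 𝕀) (hy : y ∈ 𝕀) :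
    pstar x y * binH (bP x y) = pstar x y * Real.logb 2 (pstar x y)
      - x * y * (Real.logb 2 x + Real.logb 2 y)
      - (1 - x) * (1 - y) * (Real.logb 2 (1 - x) + Real.logb 2 (1 - y)) := by
  obtain ⟨h1, h2⟩ := s_mul_b hx hy
  have e1 := (log_id h1).1
  have e2 := (log_id h2).1
  simp only [binH]
  linear_combination -e1 - e2

noncomputable def K (x y : ℝ) : ℝ := binH x + binH y - binH (pstar x y)

lemma K_eq {x y : ℝ} (hx : x ∈ 𝕀) (hy : y ∈ 𝕀) :
    K x y = pstar x y * binH (bP x y) + (1 - pstar x y) * binH (bP (1 - x) y) := by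
  have e1 := ident1 hx hy
  have e2 := ident1 (one_sub_mem hx) hy
  rw [pstar_one_sub, sub_sub_cancel] at e2
  rw [e1, e2]
  simp only [K, binH]
  ring

/-- the sum of second-moment identities -/
lemma moment2 {x y : ℝ} (hx : x ∈ 𝕀) (hy : y ∈ 𝕀) :
    binH2 (pstar x y) + (pstar x y * binH2 (bP x y)
      + pstar (1 - x) y * binH2 (bP (1 - x) y)) + 2 * (T1 x y + T1 (1 - x) y)
      = binH2 x + binH2 y + 2 * (binH x * binH y) := by
  rw [ident2 hx hy, ident2 (one_sub_mem hx) hy, pstar_one_sub, sub_sub_cancel]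
  simp only [Q, binH2, binH]
  ring

lemma T_sub {x y : ℝ} (hx : x ∈ 𝕀) (hy : y ∈ 𝕀) :
    T1 x y + T1 (1 - x) y - binH (pstar x y) * K x y =
      pstar x y * (1 - pstar x y) *
        ((Real.logb 2 (1 - pstar x y) - Real.logb 2 (pstar x y))
          * (binH (bP x y) - binH (bP (1 - x) y))) := by
  rw [K_eq hx hy]
  simp only [T1, pstar_one_sub]
  generalize binH (bP x y) = A
  generalize binH (bP (1 - x) y) = B
  simp only [binH]
  ring

lemma sq_diff {x y : ℝ} (h0 : pstar x y ≠ 0) (h1 : 1 - pstar x y ≠ 0) :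
    ((bP x y - 1/2) ^ 2 - (bP (1 - x) y - 1/2) ^ 2) * (2 * pstar x y * (1 - pstar x y)) ^ 2
     = (x - 1/2) * (y - 1/2) * (4 * x * (1 - x)) * (4 * y * (1 - y)) := by
  have e1 : (bP x y - 1/2) * (2 * pstar x y * (1 - pstar x y))
      = (x + y - 1) * (1 - pstar x y) := by
    simp only [bP]; field_simp; simp only [pstar]; ring
  have e2 : (bP (1 - x) y - 1/2) * (2 * pstar x y * (1 - pstar x y))
      = (y - x) * pstar x y := by
    simp only [bP, pstar_one_sub]; field_simp; simp only [pstar]; ring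
  have : ((bP x y - 1/2) ^ 2 - (bP (1 - x) y - 1/2) ^ 2)
      * (2 * pstar x y * (1 - pstar x y)) ^ 2 =
      ((x + y - 1) * (1 - pstar x y)) ^ 2 - ((y - x) * pstar x y) ^ 2 := by
    rw [← e1, ← e2]; ring
  rw [this]; simp only [pstar]; ring

/-- main pointwise inequality -/
lemma prod_sign {x y : ℝ} (hx : x ∈ 𝕀) (hy : y ∈ 𝕀)
    (h0 : 0 < pstar x y) (h1 : pstar x y < 1) :
    0 ≤ (Real.logb 2 (1 - pstar x y) - Real.logb 2 (pstar x y))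
          * (binH (bP x y) - binH (bP (1 - x) y)) ∧
    (x ∈ Set.Ioo (0:ℝ) 1 → y ∈ Set.Ioo (0:ℝ) 1 → x ≠ 1/2 → y ≠ 1/2 →
      0 < (Real.logb 2 (1 - pstar x y) - Real.logb 2 (pstar x y))
          * (binH (bP x y) - binH (bP (1 - x) y))) := by
  have key := sq_diff (x := x) (y := y) h0.ne' (by linarith)
  have hP : 0 < (2 * pstar x y * (1 - pstar x y)) ^ 2 := by
    have : 0 < 1 - pstar x y := by linarith
    positivity
  have hu : pstar x y - 1/2 = 2 * ((x - 1/2) * (y - 1/2)) := by simp only [pstar]; ring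
  set u := (x - 1/2) * (y - 1/2) with hudef
  have hb := dist_half (bP_mem hx hy)
  have hb' := dist_half (bP_mem (one_sub_mem hx) hy)
  have hxx : 0 ≤ 4 * x * (1 - x) := by nlinarith [hx.1, hx.2]
  have hyy : 0 ≤ 4 * y * (1 - y) := by nlinarith [hy.1, hy.2]
  have l2 : (1:ℝ) < 2 := by norm_num
  constructor
  · rcases le_total u 0 with h | h
    · apply mul_nonneg
      · have := Real.logb_le_logb_of_le l2 h0 (show pstar x y ≤ 1 - pstar x y by linarith)
        linarith
      · have : binH (bP (1 - x) y) ≤ binH (bP x y) := by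
          apply binH_le hb'
          apply sq_le_sq.1
          have : u * (4 * x * (1 - x)) * (4 * y * (1 - y)) ≤ 0 :=
            mul_nonpos_of_nonpos_of_nonneg (mul_nonpos_of_nonpos_of_nonneg h hxx) hyy
          by_contra hc
          push Not at hc
          nlinarith [mul_pos (sub_pos.2 hc) hP]
        linarith
    · apply mul_nonneg_of_nonpos_of_nonpos
      · have := Real.logb_le_logb_of_le l2 (show 0 < 1 - pstar x y by linarith)
          (show 1 - pstar x y ≤ pstar x y by linarith)
        linarith
      · have : binH (bP x y) ≤ binH (bP (1 - x) y) := by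
          apply binH_le hb
          apply sq_le_sq.1
          have : 0 ≤ u * (4 * x * (1 - x)) * (4 * y * (1 - y)) := by positivity
          by_contra hc
          push Not at hc
          nlinarith [mul_pos (sub_pos.2 hc) hP]
        linarith
  · intro ax ay bx bY
    have hxx : 0 < 4 * x * (1 - x) := by nlinarith [ax.1, ax.2]
    have hyy : 0 < 4 * y * (1 - y) := by nlinarith [ay.1, ay.2]
    have hu0 : u ≠ 0 := mul_ne_zero (sub_ne_zero.2 bx) (sub_ne_zero.2 bY)
    rcases lt_or_gt_of_ne hu0 with h | h
    · apply mul_pos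
      · have := Real.logb_lt_logb l2 h0 (show pstar x y < 1 - pstar x y by linarith)
        linarith
      · have : binH (bP (1 - x) y) < binH (bP x y) := by
          apply binH_lt hb'
          apply sq_lt_sq.1
          have : u * (4 * x * (1 - x)) * (4 * y * (1 - y)) < 0 :=
            mul_neg_of_neg_of_pos (mul_neg_of_neg_of_pos h hxx) hyy
          by_contra hc
          push Not at hc
          nlinarith [mul_nonneg (sub_nonneg.2 hc) hP.le]
        linarith
    · apply mul_pos_of_neg_of_neg
      · have := Real.logb_lt_logb l2 (show 0 < 1 - pstar x y by linarith)
          (show 1 - pstar x y < pstar x y by linarith)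
        linarith
      · have : binH (bP x y) < binH (bP (1 - x) y) := by
          apply binH_lt hb
          apply sq_lt_sq.1
          have : 0 < u * (4 * x * (1 - x)) * (4 * y * (1 - y)) := by positivity
          by_contra hc
          push Not at hc
          nlinarith [mul_nonneg (sub_nonneg.2 hc) hP.le]
        linarith

lemma T_ge {x y : ℝ} (hx : x ∈ 𝕀) (hy : y ∈ 𝕀) :
    0 ≤ T1 x y + T1 (1 - x) y - binH (pstar x y) * K x y := by
  rw [T_sub hx hy]
  have hm := pstar_mem hx hy
  rcases hm.1.eq_or_lt with h | h
  · rw [← h]; simp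
  rcases hm.2.eq_or_lt with h' | h'
  · rw [h']; simp
  exact mul_nonneg (mul_nonneg h.le (by linarith)) (prod_sign hx hy h h').1

lemma T_gt {x y : ℝ} (hx : x ∈ Set.Ioo (0:ℝ) 1) (hy : y ∈ Set.Ioo (0:ℝ) 1)
    (hx2 : x ≠ 1/2) (hy2 : y ≠ 1/2) :
    0 < T1 x y + T1 (1 - x) y - binH (pstar x y) * K x y := by
  have hx' := Set.Ioo_subset_Icc_self hx
  have hy' := Set.Ioo_subset_Icc_self hy
  rw [T_sub hx' hy']
  obtain ⟨a, b⟩ := hx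
  obtain ⟨c, d⟩ := hy
  have h : 0 < pstar x y := by simp only [pstar]; nlinarith
  have h' : pstar x y < 1 := by simp only [pstar]; nlinarith
  exact mul_pos (mul_pos h (by linarith)) ((prod_sign hx' hy' h h').2 ⟨a, b⟩ ⟨c, d⟩ hx2 hy2)

/-! Continuity -/

lemma cont_mul_logb : Continuous (fun t : ℝ => t * Real.logb 2 t) := by
  have : (fun t : ℝ => t * Real.logb 2 t) = fun t => (t * Real.log t) / Real.log 2 := by
    ext t; simp only [Real.logb]; ring
  rw [this]
  exact Real.continuous_mul_log.div_const _

/-- continuous extension of `t (log t)²` -/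
noncomputable def ql (t : ℝ) : ℝ := 4 * (√t * Real.logb 2 (√t)) ^ 2

lemma ql_cont : Continuous ql := by
  unfold ql
  exact continuous_const.mul ((cont_mul_logb.comp Real.continuous_sqrt).pow 2)

lemma ql_eq {t : ℝ} (ht : 0 ≤ t) : t * (Real.logb 2 t) ^ 2 = ql t := by
  simp only [ql, Real.logb, Real.log_sqrt ht]
  rw [mul_pow, Real.sq_sqrt ht]; ring

lemma binH2_eq {t : ℝ} (ht : t ∈ 𝕀) : binH2 t = ql t + ql (1 - t) := by
  rw [binH2, ql_eq ht.1, ql_eq (one_sub_mem ht).1]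

lemma binH2_cont : Continuous (fun t : 𝕀 => binH2 (t : ℝ)) := by
  have : (fun t : 𝕀 => binH2 (t : ℝ)) = fun t : 𝕀 => ql t + ql (1 - t) :=
    funext fun t => binH2_eq t.2
  rw [this]
  have := ql_cont
  fun_prop

lemma Q_cont : Continuous (fun x : 𝕀 × 𝕀 => Q x.1 x.2) := by
  have : (fun x : 𝕀 × 𝕀 => Q x.1 x.2) = fun x : 𝕀 × 𝕀 =>
      ql x.1 * x.2 + 2 * (x.1 * Real.logb 2 x.1) * (x.2 * Real.logb 2 x.2) + x.1 * ql x.2 := by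
    ext x
    rw [← ql_eq x.1.2.1, ← ql_eq x.2.2.1, Q]; ring
  rw [this]
  have h := ql_cont
  have h1 : Continuous (fun x : 𝕀 × 𝕀 => (x.1 : ℝ) * Real.logb 2 x.1) :=
    cont_mul_logb.comp (by fun_prop)
  have h2 : Continuous (fun x : 𝕀 × 𝕀 => (x.2 : ℝ) * Real.logb 2 x.2) :=
    cont_mul_logb.comp (by fun_prop)
  fun_prop

lemma pstar_cont : Continuous (fun x : 𝕀 × 𝕀 => pstar x.1 x.2) := by
  unfold pstar; fun_prop

lemma T1_cont : Continuous (fun x : 𝕀 × 𝕀 => T1 x.1 x.2) := by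
  have hc : Continuous (fun x : 𝕀 × 𝕀 => -(pstar x.1 x.2 * Real.logb 2 (pstar x.1 x.2))) :=
    (cont_mul_logb.comp pstar_cont).neg
  rw [continuous_iff_continuousAt]
  intro x
  by_cases h : pstar x.1 x.2 = 0
  · have hz : T1 x.1 x.2 = 0 := by simp [T1, h]
    rw [ContinuousAt, hz]
    have hc0 := hc.tendsto x
    simp only [h, zero_mul, neg_zero] at hc0
    refine squeeze_zero (fun z => ?_) (fun z => ?_) hc0
    · have hm := pstar_mem z.1.2 z.2.2
      apply mul_nonneg _ (binH_nonneg (bP_mem z.1.2 z.2.2))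
      have := Real.logb_nonpos (b := 2) (by norm_num) hm.1 hm.2
      nlinarith [hm.1]
    · have hm := pstar_mem z.1.2 z.2.2
      apply mul_le_of_le_one_right _ binH_le_one
      have := Real.logb_nonpos (b := 2) (by norm_num) hm.1 hm.2
      nlinarith [hm.1]
  · apply ContinuousAt.mul hc.continuousAt
    apply binH_cont.continuousAt.comp
    apply ContinuousAt.div _ pstar_cont.continuousAt h
    fun_prop

lemma flip_cont : Continuous (fun x : 𝕀 × 𝕀 =>
    ((⟨1 - (x.1 : ℝ), one_sub_mem x.1.2⟩, x.2) : 𝕀 × 𝕀)) := by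
  fun_prop

lemma T1_cont' : Continuous (fun x : 𝕀 × 𝕀 => T1 (1 - x.1) x.2) :=
  T1_cont.comp flip_cont

lemma G_cont : Continuous (fun x : 𝕀 × 𝕀 => binH (pstar x.1 x.2)) :=
  binH_cont.comp pstar_cont

lemma K_cont : Continuous (fun x : 𝕀 × 𝕀 => K x.1 x.2) := by
  have := binH_cont
  have := G_cont
  unfold K
  fun_prop

lemma sH2_cont : Continuous (fun x : 𝕀 × 𝕀 => pstar x.1 x.2 * binH2 (bP x.1 x.2)) := by
  have : (fun x : 𝕀 × 𝕀 => pstar x.1 x.2 * binH2 (bP x.1 x.2)) = fun x : 𝕀 × 𝕀 =>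
      Q x.1 x.2 + Q (1 - x.1) (1 - x.2) - ql (pstar x.1 x.2) - 2 * T1 x.1 x.2 := by
    ext x
    rw [ident2 x.1.2 x.2.2, ql_eq (pstar_mem x.1.2 x.2.2).1]
  rw [this]
  have h1 := Q_cont
  have h2 : Continuous (fun x : 𝕀 × 𝕀 => Q (1 - x.1) (1 - x.2)) :=
    Q_cont.comp (g := fun x : 𝕀 × 𝕀 => Q x.1 x.2) (f := fun x : 𝕀 × 𝕀 =>
      ((⟨1 - (x.1 : ℝ), one_sub_mem x.1.2⟩, ⟨1 - (x.2 : ℝ), one_sub_mem x.2.2⟩) : 𝕀 × 𝕀))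
      (by fun_prop)
  have h3 := ql_cont.comp pstar_cont
  have h4 := T1_cont
  exact ((h1.add h2).sub h3).sub (h4.const_mul 2)

lemma sH_cont : Continuous (fun x : 𝕀 × 𝕀 => pstar x.1 x.2 * binH (bP x.1 x.2)) := by
  have : (fun x : 𝕀 × 𝕀 => pstar x.1 x.2 * binH (bP x.1 x.2)) = fun x : 𝕀 × 𝕀 =>
      pstar x.1 x.2 * Real.logb 2 (pstar x.1 x.2)
      - (x.2 * (x.1 * Real.logb 2 x.1) + x.1 * (x.2 * Real.logb 2 x.2))
      - ((1 - x.2) * ((1 - x.1) * Real.logb 2 (1 - x.1))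
        + (1 - x.1) * ((1 - x.2) * Real.logb 2 (1 - x.2))) := by
    ext x
    rw [ident1 x.1.2 x.2.2]; ring
  rw [this]
  have h0 : Continuous (fun x : 𝕀 × 𝕀 => pstar x.1 x.2 * Real.logb 2 (pstar x.1 x.2)) :=
    cont_mul_logb.comp pstar_cont
  have h1 : Continuous (fun x : 𝕀 × 𝕀 => (x.1 : ℝ) * Real.logb 2 x.1) :=
    cont_mul_logb.comp (by fun_prop)
  have h2 : Continuous (fun x : 𝕀 × 𝕀 => (x.2 : ℝ) * Real.logb 2 x.2) :=
    cont_mul_logb.comp (by fun_prop)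
  have h3 : Continuous (fun x : 𝕀 × 𝕀 => (1 - x.1 : ℝ) * Real.logb 2 (1 - x.1)) :=
    cont_mul_logb.comp (by fun_prop)
  have h4 : Continuous (fun x : 𝕀 × 𝕀 => (1 - x.2 : ℝ) * Real.logb 2 (1 - x.2)) :=
    cont_mul_logb.comp (by fun_prop)
  fun_prop

lemma integ {X : Type*} [TopologicalSpace X] [CompactSpace X] [MeasurableSpace X]
    [BorelSpace X] (μ : Measure X) [IsFiniteMeasure μ] {f : X → ℝ}
    (hf : Continuous f) : Integrable f μ :=
  hf.integrable_of_hasCompactSupport (HasCompactSupport.of_compactSpace f)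

lemma cheb (F : Measure 𝕀) [IsProbabilityMeasure F] {f h : 𝕀 → ℝ} (hf : Continuous f)
    (hh : Continuous h) (hm : ∀ x y, 0 ≤ (f x - f y) * (h x - h y)) :
    (∫ x, f x ∂F) * (∫ x, h x ∂F) ≤ ∫ x, f x * h x ∂F := by
  have if_ := integ F hf
  have ih := integ F hh
  have ifh := integ F (hf.mul hh)
  set A := ∫ x, f x ∂F with hA
  set B := ∫ x, h x ∂F with hB
  set C := ∫ x, f x * h x ∂F with hC
  have h1 : ∀ x, 0 ≤ f x * h x - f x * B - A * h x + C := by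
    intro x
    have e : ∫ y, (f x - f y) * (h x - h y) ∂F = f x * h x - f x * B - A * h x + C := by
      have : (fun y => (f x - f y) * (h x - h y)) =
          fun y => f x * h x - f x * h y - f y * h x + f y * h y := by ext y; ring
      rw [this, integral_add, integral_sub, integral_sub, integral_const_mul, integral_mul_const]
      · simp only [integral_const, probReal_univ, one_smul]
        rw [integral_const_mul]
      all_goals first | exact integ F (by fun_prop)
    rw [← e]
    exact integral_nonneg (hm x)
  have h2 : 0 ≤ ∫ x, (f x * h x - f x * B - A * h x + C) ∂F := integral_nonneg h1
  rw [integral_add, integral_sub, integral_sub, integral_const_mul, integral_mul_const] at h2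
  · simp only [integral_const, probReal_univ, one_smul] at h2
    linarith
  all_goals exact integ F (by fun_prop)

lemma pstar_comm (x y : ℝ) : pstar x y = pstar y x := by simp only [pstar]; ring

lemma K_comm (x y : ℝ) : K x y = K y x := by simp only [K, pstar_comm x y]; ring

lemma GK_mono (x x' c : 𝕀) (h : |(x':ℝ) - 1/2| ≤ |(x:ℝ) - 1/2|) :
    binH (pstar x c) ≤ binH (pstar x' c) ∧ K x c ≤ K x' c := by
  refine ⟨G_mono x.2 c.2 h, ?_⟩
  have := K_mono x.2 c.2 h
  simp only [K]; linarith

lemma param_cont (F : Measure 𝕀) [IsProbabilityMeasure F] {f : 𝕀 × 𝕀 → ℝ} (hf : Continuous f) :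
    Continuous (fun x => ∫ y, f (x, y) ∂F) := by
  have := continuous_parametric_integral_of_continuous (μ := F) (f := fun x y => f (x, y))
    (by simpa [Function.uncurry_def] using hf) isCompact_univ
  simpa using this

lemma harris (F : Measure 𝕀) [IsProbabilityMeasure F] :
    (∫ x : 𝕀 × 𝕀, binH (pstar x.1 x.2) ∂(F.prod F)) * (∫ x : 𝕀 × 𝕀, K x.1 x.2 ∂(F.prod F))
      ≤ ∫ x : 𝕀 × 𝕀, binH (pstar x.1 x.2) * K x.1 x.2 ∂(F.prod F) := by
  have hGK : Continuous (fun x : 𝕀 × 𝕀 => binH (pstar x.1 x.2) * K x.1 x.2) := G_cont.mul K_cont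
  rw [integral_prod _ (integ _ G_cont), integral_prod _ (integ _ K_cont),
    integral_prod _ (integ _ hGK)]
  have cG := param_cont F G_cont
  have cK := param_cont F K_cont
  have cGK := param_cont F hGK
  refine (cheb F cG cK ?_).trans ?_
  · intro x y
    rcases le_total |(y:ℝ) - 1/2| |(x:ℝ) - 1/2| with h | h
    · apply mul_nonneg_of_nonpos_of_nonpos
      · rw [sub_nonpos]
        exact integral_mono (integ F (G_cont.comp (Continuous.prodMk_right x)))
          (integ F (G_cont.comp (Continuous.prodMk_right y))) fun c => (GK_mono x y c h).1
      · rw [sub_nonpos]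
        exact integral_mono (integ F (K_cont.comp (Continuous.prodMk_right x)))
          (integ F (K_cont.comp (Continuous.prodMk_right y))) fun c => (GK_mono x y c h).2
    · apply mul_nonneg
      · rw [sub_nonneg]
        exact integral_mono (integ F (G_cont.comp (Continuous.prodMk_right y)))
          (integ F (G_cont.comp (Continuous.prodMk_right x))) fun c => (GK_mono y x c h).1
      · rw [sub_nonneg]
        exact integral_mono (integ F (K_cont.comp (Continuous.prodMk_right y)))
          (integ F (K_cont.comp (Continuous.prodMk_right x))) fun c => (GK_mono y x c h).2
  · refine integral_mono (integ F (cG.mul cK)) (integ F cGK) fun x => ?_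
    refine cheb F (G_cont.comp (Continuous.prodMk_right x))
      (K_cont.comp (Continuous.prodMk_right x)) ?_
    intro y z
    dsimp only
    rw [pstar_comm x y, pstar_comm x z, K_comm x y, K_comm x z]
    rcases le_total |(y:ℝ) - 1/2| |(z:ℝ) - 1/2| with h | h
    · have := GK_mono z y x h
      exact mul_nonneg (by linarith) (by linarith)
    · have := GK_mono y z x h
      exact mul_nonneg_of_nonpos_of_nonpos (by linarith) (by linarith)

noncomputable def T (x : 𝕀 × 𝕀) : ℝ := T1 x.1 x.2 + T1 (1 - x.1) x.2

lemma T_cont : Continuous T := T1_cont.add T1_cont'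

lemma starMap_meas : Measurable starMap := by
  apply Measurable.subtype_mk
  exact pstar_cont.measurable

lemma plusMap₁_meas : Measurable plusMap₁ := by
  apply Measurable.subtype_mk
  exact Measurable.div (by fun_prop) pstar_cont.measurable

lemma pstar_cont' : Continuous (fun x : 𝕀 × 𝕀 => pstar (1 - x.1) x.2) :=
  pstar_cont.comp flip_cont

lemma plusMap₂_meas : Measurable plusMap₂ := by
  apply Measurable.subtype_mk
  exact Measurable.div (by fun_prop) pstar_cont'.measurable

lemma integral_minus (F : Measure 𝕀) [IsProbabilityMeasure F] {f : ℝ → ℝ}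
    (hf : Continuous (fun t : 𝕀 => f t)) :
    ∫ a, f a ∂(Fminus F) = ∫ x : 𝕀 × 𝕀, f (pstar x.1 x.2) ∂(F.prod F) := by
  rw [Fminus, integral_map starMap_meas.aemeasurable hf.aestronglyMeasurable]
  rfl

lemma integral_plus (F : Measure 𝕀) [IsProbabilityMeasure F] {f : ℝ → ℝ}
    (hf : Continuous (fun t : 𝕀 => f t))
    (hc : Continuous (fun x : 𝕀 × 𝕀 => pstar x.1 x.2 * f (bP x.1 x.2))) :
    ∫ a, f a ∂(Fplus F) = ∫ x : 𝕀 × 𝕀, (pstar x.1 x.2 * f (bP x.1 x.2)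
      + pstar (1 - x.1) x.2 * f (bP (1 - x.1) x.2)) ∂(F.prod F) := by
  have hc' : Continuous (fun x : 𝕀 × 𝕀 => pstar (1 - x.1) x.2 * f (bP (1 - x.1) x.2)) :=
    hc.comp flip_cont
  have m1 : Measurable (fun x : 𝕀 × 𝕀 => ENNReal.ofReal (pstar x.1 x.2)) :=
    pstar_cont.measurable.ennreal_ofReal
  have m2 : Measurable (fun x : 𝕀 × 𝕀 => ENNReal.ofReal (pstar (1 - x.1) x.2)) :=
    pstar_cont'.measurable.ennreal_ofReal
  have f1 : IsFiniteMeasure ((F.prod F).withDensity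
      (fun x => ENNReal.ofReal (pstar x.1 x.2))) :=
    isFiniteMeasure_withDensity_ofReal (integ _ pstar_cont).2
  have f2 : IsFiniteMeasure ((F.prod F).withDensity
      (fun x => ENNReal.ofReal (pstar (1 - (x.1 : ℝ)) x.2))) :=
    isFiniteMeasure_withDensity_ofReal (integ _ pstar_cont').2
  rw [Fplus, integral_add_measure (integ _ hf) (integ _ hf),
    integral_map plusMap₁_meas.aemeasurable hf.aestronglyMeasurable,
    integral_map plusMap₂_meas.aemeasurable hf.aestronglyMeasurable,
    integral_withDensity_eq_integral_toReal_smul m1 (by simp),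
    integral_withDensity_eq_integral_toReal_smul m2 (by simp),
    integral_add (integ _ hc) (integ _ hc')]
  congr 1
  · refine integral_congr_ae (Filter.Eventually.of_forall fun x => ?_)
    simp only [smul_eq_mul, ENNReal.toReal_ofReal (pstar_mem x.1.2 x.2.2).1]
    rfl
  · refine integral_congr_ae (Filter.Eventually.of_forall fun x => ?_)
    simp only [smul_eq_mul, ENNReal.toReal_ofReal (pstar_mem (one_sub_mem x.1.2) x.2.2).1]
    rfl

lemma integral_fst' (F : Measure 𝕀) [IsProbabilityMeasure F] (f : 𝕀 → ℝ) :
    ∫ x : 𝕀 × 𝕀, f x.1 ∂(F.prod F) = ∫ a, f a ∂F := by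
  have := integral_prod_mul (μ := F) (ν := F) f (fun _ => (1:ℝ))
  simpa using this

lemma integral_snd' (F : Measure 𝕀) [IsProbabilityMeasure F] (f : 𝕀 → ℝ) :
    ∫ x : 𝕀 × 𝕀, f x.2 ∂(F.prod F) = ∫ a, f a ∂F := by
  have := integral_prod_mul (μ := F) (ν := F) (fun _ => (1:ℝ)) f
  simpa using this

lemma CF_eq (F : Measure 𝕀) [IsProbabilityMeasure F] :
    CF F = ∫ x, T x ∂(F.prod F) - (∫ x : 𝕀 × 𝕀, binH (pstar x.1 x.2) ∂(F.prod F))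
      * (∫ x : 𝕀 × 𝕀, K x.1 x.2 ∂(F.prod F)) := by
  have hH : Continuous (fun t : 𝕀 => binH t) := binH_cont.comp continuous_subtype_val
  have hH1 : Continuous (fun x : 𝕀 × 𝕀 => binH x.1) := hH.comp continuous_fst
  have hH2 : Continuous (fun x : 𝕀 × 𝕀 => binH x.2) := hH.comp continuous_snd
  have hS1 : Continuous (fun x : 𝕀 × 𝕀 => binH2 x.1) := binH2_cont.comp continuous_fst
  have hS2 : Continuous (fun x : 𝕀 × 𝕀 => binH2 x.2) := binH2_cont.comp continuous_snd
  have hS : Continuous (fun x : 𝕀 × 𝕀 => binH2 (pstar x.1 x.2)) :=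
    binH2_cont.comp (g := fun t : 𝕀 => binH2 t) (f := starMap) (pstar_cont.subtype_mk _)
  have hP : Continuous (fun x : 𝕀 × 𝕀 => pstar x.1 x.2 * binH2 (bP x.1 x.2)
      + pstar (1 - x.1) x.2 * binH2 (bP (1 - x.1) x.2)) :=
    sH2_cont.add (sH2_cont.comp flip_cont)
  have eK : ∫ a, binH a ∂(Fplus F) = ∫ x : 𝕀 × 𝕀, K x.1 x.2 ∂(F.prod F) := by
    rw [integral_plus F hH sH_cont]
    refine integral_congr_ae (Filter.Eventually.of_forall fun x => ?_)
    simp only [K_eq x.1.2 x.2.2, pstar_one_sub]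
  have eK2 : ∫ x : 𝕀 × 𝕀, K x.1 x.2 ∂(F.prod F)
      = 2 * ∫ a, binH a ∂F - ∫ x : 𝕀 × 𝕀, binH (pstar x.1 x.2) ∂(F.prod F) := by
    simp only [K]
    rw [integral_sub (integ _ (hH1.fun_add hH2)) (integ _ G_cont),
      integral_add (integ _ hH1) (integ _ hH2), integral_fst' F (fun a => binH a),
      integral_snd' F (fun a => binH a)]
    ring
  have e2 : (∫ x : 𝕀 × 𝕀, binH2 (pstar x.1 x.2) ∂(F.prod F))
      + (∫ x : 𝕀 × 𝕀, (pstar x.1 x.2 * binH2 (bP x.1 x.2)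
      + pstar (1 - x.1) x.2 * binH2 (bP (1 - x.1) x.2)) ∂(F.prod F))
      + 2 * ∫ x, T x ∂(F.prod F) = 2 * (∫ a, binH2 a ∂F) + 2 * (∫ a, binH a ∂F) ^ 2 := by
    rw [← integral_const_mul, ← integral_add (integ _ hS) (integ _ hP),
      ← integral_add (integ _ (hS.fun_add hP)) (integ _ (T_cont.const_mul 2))]
    have : ∀ x : 𝕀 × 𝕀, binH2 (pstar x.1 x.2) + (pstar x.1 x.2 * binH2 (bP x.1 x.2)
      + pstar (1 - x.1) x.2 * binH2 (bP (1 - x.1) x.2)) + 2 * T x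
      = binH2 x.1 + binH2 x.2 + 2 * (binH x.1 * binH x.2) := fun x => moment2 x.1.2 x.2.2
    simp only [this]
    rw [integral_add (integ _ (hS1.fun_add hS2)) (integ _ ((hH1.fun_mul hH2).const_mul 2)),
      integral_add (integ _ hS1) (integ _ hS2), integral_const_mul,
      integral_fst' F (fun a => binH2 a), integral_snd' F (fun a => binH2 a),
      integral_prod_mul (fun a : 𝕀 => binH a) (fun a : 𝕀 => binH a)]
    ring
  rw [CF, VF, VF, VF, eK, integral_minus F hH, integral_minus F binH2_cont,
    integral_plus F binH2_cont sH2_cont]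
  set A := ∫ a, binH a ∂F
  set B := ∫ x : 𝕀 × 𝕀, binH (pstar x.1 x.2) ∂(F.prod F)
  rw [eK2]
  linear_combination (-1/2) * e2

lemma binH_zero : binH 0 = 0 := by simp [binH]
lemma binH_one : binH 1 = 0 := by simp [binH]
lemma binH_half : binH (1/2) = 1 := by
  rw [binH_eq, one_div, Real.binEntropy_two_inv, div_self log2_pos.ne']

lemma logb_half : Real.logb 2 (1/2) = -1 := by
  rw [one_div, Real.logb_inv, Real.logb_self_eq_one (by norm_num)]

lemma CF_pos (F : Measure 𝕀) [IsProbabilityMeasure F] (hV : 0 < VF F) : 0 < CF F := by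
  rw [CF_eq]
  have hGK : Continuous (fun x : 𝕀 × 𝕀 => binH (pstar x.1 x.2) * K x.1 x.2) := G_cont.mul K_cont
  have hD : Continuous (fun x : 𝕀 × 𝕀 => T x - binH (pstar x.1 x.2) * K x.1 x.2) :=
    T_cont.sub hGK
  have hDn : 0 ≤ fun x : 𝕀 × 𝕀 => T x - binH (pstar x.1 x.2) * K x.1 x.2 :=
    fun x => T_ge x.1.2 x.2.2
  have hsplit := integral_sub (integ (F.prod F) T_cont) (integ (F.prod F) hGK)
  have hh := harris F
  let S : Set (Set.Icc (0:ℝ) 1) := {t | t.1 ∈ Set.Ioo (0:ℝ) 1 ∧ t.1 ≠ 1/2}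
  by_cases hS : F S = 0
  · have h0 : 0 ≤ ∫ x : 𝕀 × 𝕀, (T x - binH (pstar x.1 x.2) * K x.1 x.2) ∂(F.prod F) :=
      integral_nonneg hDn
    have hae : ∀ᵐ a : 𝕀 ∂F, (a:ℝ) = 0 ∨ (a:ℝ) = 1/2 ∨ (a:ℝ) = 1 := by
      have : ∀ᵐ a : 𝕀 ∂F, a ∉ S := measure_eq_zero_iff_ae_notMem.1 hS
      filter_upwards [this] with a ha
      by_contra hc
      push Not at hc
      exact ha ⟨⟨lt_of_le_of_ne a.2.1 hc.1.symm, lt_of_le_of_ne a.2.2 hc.2.2⟩, hc.2.1⟩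
    have eV : ∫ a, binH2 a ∂F = ∫ a, binH a ∂F := by
      apply integral_congr_ae
      filter_upwards [hae] with a ha
      rcases ha with h | h | h <;> simp only [h]
      · simp [binH, binH2]
      · rw [binH_half]; norm_num [binH2, logb_half]
      · simp [binH, binH2]
    have hae1 : ∀ᵐ x ∂(F.prod F), (x.1:ℝ) = 0 ∨ (x.1:ℝ) = 1/2 ∨ (x.1:ℝ) = 1 :=
      (Measure.quasiMeasurePreserving_fst (μ := F) (ν := F)).ae (p := fun a : 𝕀 => (a:ℝ) = 0 ∨ (a:ℝ) = 1/2 ∨ (a:ℝ) = 1) hae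
    have hae2 : ∀ᵐ x ∂(F.prod F), (x.2:ℝ) = 0 ∨ (x.2:ℝ) = 1/2 ∨ (x.2:ℝ) = 1 :=
      (Measure.quasiMeasurePreserving_snd (μ := F) (ν := F)).ae (p := fun a : 𝕀 => (a:ℝ) = 0 ∨ (a:ℝ) = 1/2 ∨ (a:ℝ) = 1) hae
    have key : ∀ᵐ x ∂(F.prod F), K x.1 x.2 = binH x.1 * binH x.2 ∧
        binH (pstar x.1 x.2) * K x.1 x.2 = binH x.1 * binH x.2 := by
      filter_upwards [hae1, hae2] with x h1 h2
      rcases h1 with h1 | h1 | h1 <;> rcases h2 with h2 | h2 | h2 <;>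
        simp only [h1, h2, K, pstar] <;> norm_num [binH_zero, binH_one, binH_half]
    have hH : Continuous (fun t : 𝕀 => binH t) := binH_cont.comp continuous_subtype_val
    have hH1 : Continuous (fun x : 𝕀 × 𝕀 => binH x.1) := hH.comp continuous_fst
    have hH2 : Continuous (fun x : 𝕀 × 𝕀 => binH x.2) := hH.comp continuous_snd
    have eP := integral_prod_mul (μ := F) (ν := F) (fun a : 𝕀 => binH a) (fun a : 𝕀 => binH a)
    have eK : ∫ x : 𝕀 × 𝕀, K x.1 x.2 ∂(F.prod F) = (∫ a, binH a ∂F) * (∫ a, binH a ∂F) := by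
      rw [← eP]; apply integral_congr_ae
      filter_upwards [key] with x hx using hx.1
    have eGK : ∫ x : 𝕀 × 𝕀, binH (pstar x.1 x.2) * K x.1 x.2 ∂(F.prod F)
        = (∫ a, binH a ∂F) * (∫ a, binH a ∂F) := by
      rw [← eP]; apply integral_congr_ae
      filter_upwards [key] with x hx using hx.2
    have eK2 : ∫ x : 𝕀 × 𝕀, K x.1 x.2 ∂(F.prod F)
        = 2 * ∫ a, binH a ∂F - ∫ x : 𝕀 × 𝕀, binH (pstar x.1 x.2) ∂(F.prod F) := by
      simp only [K]
      rw [integral_sub (integ _ (hH1.fun_add hH2)) (integ _ G_cont),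
        integral_add (integ _ hH1) (integ _ hH2), integral_fst' F (fun a => binH a),
        integral_snd' F (fun a => binH a)]
      ring
    rw [VF, eV] at hV
    rw [hsplit, eGK] at h0
    set h := ∫ a, binH a ∂F
    have : ∫ x : 𝕀 × 𝕀, binH (pstar x.1 x.2) ∂(F.prod F) = 2 * h - h * h := by linarith
    rw [this, eK]
    nlinarith [mul_pos hV hV]
  · have h0 : 0 < ∫ x : 𝕀 × 𝕀, (T x - binH (pstar x.1 x.2) * K x.1 x.2) ∂(F.prod F) := by
      rw [integral_pos_iff_support_of_nonneg hDn (integ _ hD)]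
      have hp : 0 < (F.prod F) (S ×ˢ S) := by
        rw [Measure.prod_prod]
        exact ENNReal.mul_pos hS hS
      refine hp.trans_le (measure_mono ?_)
      rintro ⟨x, y⟩ ⟨hx, hy⟩
      exact (T_gt hx.1 hy.1 hx.2 hy.2).ne'
    rw [hsplit] at h0
    linarith

lemma cont_int {X : Type*} [TopologicalSpace X] [CompactSpace X] [MeasurableSpace X]
    [BorelSpace X] {f : X → ℝ} (hf : Continuous f) :
    Continuous (fun μ : ProbabilityMeasure X => ∫ x, f x ∂(μ : Measure X)) :=
  ProbabilityMeasure.continuous_integral_boundedContinuousFunction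
    (BoundedContinuousFunction.mkOfCompact ⟨f, hf⟩)

lemma cont_int2 {f : 𝕀 × 𝕀 → ℝ} (hf : Continuous f) :
    Continuous (fun μ : ProbabilityMeasure 𝕀 => ∫ x, f x ∂((μ : Measure 𝕀).prod (μ : Measure 𝕀))) :=
  (cont_int hf).comp (ProbabilityMeasure.continuous_prod.comp (continuous_id.prodMk continuous_id))

lemma VF_cont : Continuous (fun μ : ProbabilityMeasure 𝕀 => VF (μ : Measure 𝕀)) :=
  (cont_int binH2_cont).sub ((cont_int (binH_cont.comp continuous_subtype_val)).pow 2)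

lemma CF_cont : Continuous (fun μ : ProbabilityMeasure 𝕀 => CF (μ : Measure 𝕀)) := by
  simp only [CF_eq]
  exact (cont_int2 T_cont).sub ((cont_int2 G_cont).mul (cont_int2 K_cont))

end PolarAux

/-- For every `δ > 0` there is `Δ > 0` such that `C(F) ≥ Δ` for every Borel probability
measure `F` on `[0,1]` with `V(F) ≥ δ`. -/
theorem CF_uniformly_positive (δ : ℝ) (hδ : 0 < δ) :
    ∃ Δ : ℝ, 0 < Δ ∧ ∀ F : Measure (Set.Icc (0:ℝ) 1),
      IsProbabilityMeasure F → δ ≤ VF F → Δ ≤ CF F := by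
  have hcl : IsCompact {μ : ProbabilityMeasure (Set.Icc (0:ℝ) 1) |
      δ ≤ VF (μ : Measure (Set.Icc (0:ℝ) 1))} :=
    (isClosed_le continuous_const PolarAux.VF_cont).isCompact
  rcases Set.eq_empty_or_nonempty {μ : ProbabilityMeasure (Set.Icc (0:ℝ) 1) |
      δ ≤ VF (μ : Measure (Set.Icc (0:ℝ) 1))} with he | hne
  · refine ⟨1, one_pos, fun F hF hV => ?_⟩
    exact absurd (show (⟨F, hF⟩ : ProbabilityMeasure (Set.Icc (0:ℝ) 1)) ∈ _ from hV)
      (Set.eq_empty_iff_forall_notMem.1 he _)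
  · obtain ⟨μ, hμ, hmin⟩ := hcl.exists_isMinOn hne PolarAux.CF_cont.continuousOn
    refine ⟨CF (μ : Measure (Set.Icc (0:ℝ) 1)),
      PolarAux.CF_pos _ (lt_of_lt_of_le hδ hμ), fun F hF hV => ?_⟩
    exact hmin (show (⟨F, hF⟩ : ProbabilityMeasure (Set.Icc (0:ℝ) 1)) ∈ _ from hV)
end
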